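/- arXiv:1807.10988 — 2 statements merged into one kernel-verified Lean document; each statement's English description precedes it below -/
import Mathlib

section
/- Let G be a connected graph with a Naji-system solution β. If β is not chordal, then G contains an induced subgraph H such that β restricted to H is not chordal and H is isomorphic either to the claw K_{1,3} or to K₄. -/
/-- A solution to the Naji system of a graph `G`. -/
def NajiSolution {V : Type*} (G : SimpleGraph V) (β : V → V → ZMod 2) : Prop :=
  (∀ v w : V, G.Adj v w → β v w + β w v = 1) ∧
  (∀ x v w : V, x ≠ v → x ≠ w → G.Adj v w → ¬G.Adj x v → ¬G.Adj x w →
    β x v + β x w = 0) ∧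
  (∀ x v w : V, v ≠ w → G.Adj x v → G.Adj x w → ¬G.Adj v w →
    β v w + β w v + β x v + β x w = 1)

/-- Cyclic betweenness on `Fin m`: `k` lies strictly inside the clockwise arc
from `p` to `q`. -/
def cycBtw {m : ℕ} (p k q : Fin m) : Prop :=
  if p < q then p < k ∧ k < q else p < k ∨ k < q

/-- An oriented chord diagram for `G`: a cyclic double occurrence word on the
vertex set (each vertex appears exactly twice, once marked as head and once as
tail), with two vertices adjacent iff their occurrences interleave. -/
structure OCD {V : Type*} [Fintype V] [DecidableEq V] (G : SimpleGraph V) where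
  word : Fin (2 * Fintype.card V) → V
  isHead : Fin (2 * Fintype.card V) → Bool
  occ_two : ∀ v : V, (Finset.univ.filter fun i => word i = v).card = 2
  head_one : ∀ v : V, (Finset.univ.filter fun i => word i = v ∧ isHead i = true).card = 1
  adj_iff : ∀ u v : V, u ≠ v →
    (G.Adj u v ↔ ∃ i j : Fin (2 * Fintype.card V), i < j ∧ word i = u ∧ word j = u ∧
      (Finset.univ.filter fun k => word k = v ∧ i < k ∧ k < j).card = 1)

/-- The diagram `D` realizes `β`: `β u v = 0` exactly when the head of the chord
`v` is encountered travelling clockwise from the head of `u` to the tail of `u`. -/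
def OCD.Realizes {V : Type*} [Fintype V] [DecidableEq V] {G : SimpleGraph V}
    (D : OCD G) (β : V → V → ZMod 2) : Prop :=
  ∀ u v : V, u ≠ v → ∀ hu tu hv : Fin (2 * Fintype.card V),
    D.word hu = u → D.isHead hu = true → D.word tu = u → D.isHead tu = false →
    D.word hv = v → D.isHead hv = true →
    (β u v = 0 ↔ cycBtw hu hv tu)

/-- A solution `β` is chordal if some oriented chord diagram for `G` realizes it. -/
def NajiChordal {V : Type*} [Fintype V] [DecidableEq V] (G : SimpleGraph V)
    (β : V → V → ZMod 2) : Prop :=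
  ∃ D : OCD G, D.Realizes β

/-- The claw `K_{1,3}` on `Fin 4`, with centre `0`. -/
def clawGraph : SimpleGraph (Fin 4) :=
  SimpleGraph.fromRel (fun u _ => u = 0)

section CyclicOrder

variable {α : Type*} [LinearOrder α]

/-- Strict cyclic betweenness in a linear order: travelling upwards from `p`, and wrapping around
at the end, one meets `k` before `q`. -/
def Cyc (p k q : α) : Prop :=
  (p < k ∧ k < q) ∨ (k < q ∧ q < p) ∨ (q < p ∧ p < k)

/-- Four points met in this cyclic order. -/
def CycFour (a b c d : α) : Prop :=
  Cyc a b c ∧ Cyc c d a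

theorem cycBtw_iff_cyc {m : ℕ} {p k q : Fin m} (hpq : p ≠ q) :
    cycBtw p k q ↔ Cyc p k q := by
  unfold cycBtw Cyc
  split <;> grind

theorem cyc_map_iff {γ : Type*} [LinearOrder γ] {e : α → γ} (he : StrictMono e) {p k q : α} :
    Cyc (e p) (e k) (e q) ↔ Cyc p k q := by
  simp only [Cyc, he.lt_iff_lt]

theorem not_cyc_iff {p k q : α} (hpk : p ≠ k) (hkq : k ≠ q) (hpq : p ≠ q) :
    ¬Cyc p k q ↔ Cyc q k p := by
  unfold Cyc; grind

theorem CycFour.rotate {a b c d : α} (h : CycFour a b c d) : CycFour b c d a := by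
  unfold CycFour Cyc at *; grind

theorem CycFour.cyc {a b c d : α} (h : CycFour a b c d) : Cyc d a b := by
  unfold CycFour Cyc at *; grind

theorem CycFour.replace {a b c d e : α} (h : CycFour a b c d) (he : Cyc d e b) :
    CycFour b c d e := by
  unfold CycFour Cyc at *; grind

theorem cyc_of_separated {h t q₁ q₂ e m : α} (hm : m = h ∨ m = t) (_ : h ≠ q₁) (_ : t ≠ q₁)
    (_ : h ≠ q₂) (_ : t ≠ q₂) (_ : h ≠ t) (_ : e ≠ h) (_ : e ≠ t)
    (hq : Cyc h q₁ t ↔ Cyc h q₂ t) (he : ¬(Cyc h e t ↔ Cyc h q₁ t)) (hc : Cyc q₂ m q₁) :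
    Cyc q₂ e q₁ := by
  unfold Cyc at *; grind

/-- A transversal `h t` of a family of chords sees them in an acyclic order. -/
theorem not_cyclic_of_transversal {h t pa qa pb qb pc qc : α}
    (hpa : Cyc h pa t) (hpb : Cyc h pb t) (hpc : Cyc h pc t)
    (hqa : Cyc t qa h) (hqb : Cyc t qb h) (hqc : Cyc t qc h)
    (hab : pa ≠ pb) (hac : pa ≠ pc) :
    ¬((Cyc pa pb qa ↔ Cyc pb pc qb) ∧ (Cyc pb pc qb ↔ Cyc pc pa qc)) := by
  unfold Cyc at *; grind

theorem cyc_of_three_disjoint {xh xt wh wt uh ut : α} (hd : [xh, xt, wh, wt, uh, ut].Nodup)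
    (hxu : Cyc xh uh xt ↔ Cyc xh ut xt) (hxw : Cyc xh wh xt ↔ Cyc xh wt xt)
    (hwu : Cyc wh uh wt ↔ Cyc wh ut wt) (hwx : Cyc wh xh wt ↔ Cyc wh xt wt)
    (hux : Cyc uh xh ut ↔ Cyc uh xt ut) (huw : Cyc uh wh ut ↔ Cyc uh wt ut)
    (h : ¬(Cyc xh uh xt ↔ Cyc xh wh xt)) : Cyc wh uh wt ↔ Cyc wh xh wt := by
  simp at hd
  unfold Cyc at *; grind

/-- If the chord `h t` separates `q` from both ends of the chord `u`, then `h`, `t` and `q` lie on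
the same side of `u`. -/
theorem cyc_two_ends {uh ut h t q : α} (hd : [uh, ut, h, t].Nodup) (_ : q ≠ uh) (_ : q ≠ ut)
    (hq : ¬(Cyc h q t ↔ Cyc h uh t)) (hu : Cyc h uh t ↔ Cyc h ut t) :
    (Cyc uh h ut ↔ Cyc uh q ut) ∧ (Cyc uh t ut ↔ Cyc uh q ut) := by
  simp at hd
  unfold Cyc at *; grind

theorem cyc_ends_of_crossing {uh ut h t : α} (hd : [uh, ut, h, t].Nodup)
    (hu : ¬(Cyc h uh t ↔ Cyc h ut t)) :
    (Cyc uh h ut ↔ ¬Cyc h uh t) ∧ (Cyc uh t ut ↔ Cyc h uh t) := by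
  simp at hd
  unfold Cyc at *; grind

theorem two_chords_not_alternating {pa qa pb qb : α}
    (hab : Cyc pa pb qa ↔ ¬Cyc pb pa qb) :
    ¬CycFour pa qa pb qb ∧ ¬CycFour pa qb pb qa := by
  unfold CycFour Cyc at *; grind

theorem three_chords_not_alternating {pa qa pb qb pc qc : α}
    (hab : Cyc pa pb qa ↔ ¬Cyc pb pa qb) (hac : Cyc pa pc qa ↔ ¬Cyc pc pa qc)
    (hbc : Cyc pb pc qb ↔ ¬Cyc pc pb qc)
    (hcross : ¬(Cyc pa pb qa ↔ Cyc pa qb qa) → ¬(Cyc pa pc qa ↔ Cyc pa qc qa) →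
      ¬(Cyc pb pc qb ↔ Cyc pb qc qb) →
      ¬((Cyc pa pb qa ↔ Cyc pb pc qb) ∧ (Cyc pb pc qb ↔ Cyc pc pa qc))) :
    ¬CycFour pa qa pb qc ∧ ¬CycFour pa qb pc qa := by
  unfold CycFour
  constructor
  · unfold Cyc at *; grind (splits := 40)
  · unfold Cyc at *; grind (splits := 40)

theorem separated_iff_of_lt {i j a b : α} (hij : i < j) (_ : a ≠ i) (_ : a ≠ j) (_ : b ≠ i)
    (_ : b ≠ j) :
    (¬((i < a ∧ a < j) ↔ (i < b ∧ b < j)) ↔ ¬(Cyc i a j ↔ Cyc i b j)) ∧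
    (¬((i < a ∧ a < j) ↔ (i < b ∧ b < j)) ↔ ¬(Cyc j a i ↔ Cyc j b i)) := by
  unfold Cyc; grind

end CyclicOrder

section Cut

theorem exists_lt_forall_lt {ι : Type*} (E : Finset ι) (g : ι → ℚ) (b : ℚ) :
    ∃ y < b, ∀ i ∈ E, g i < b → g i < y := by
  classical
  induction E using Finset.induction_on with
  | empty => exact ⟨b - 1, by linarith, by simp⟩
  | insert a E _ ih =>
    obtain ⟨y, hy, h⟩ := ih
    by_cases ha : g a < b
    · obtain ⟨z, hz, hzb⟩ := exists_between (max_lt hy ha)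
      exact ⟨z, hzb, by grind⟩
    · exact ⟨y, hy, by grind⟩

theorem exists_gt_forall_gt {ι : Type*} (E : Finset ι) (g : ι → ℚ) (b : ℚ) :
    ∃ y > b, ∀ i ∈ E, b < g i → y < g i := by
  obtain ⟨y, hy, h⟩ := exists_lt_forall_lt E (fun i => -g i) (-b)
  exact ⟨-y, by linarith, fun i hi hb => by linarith [h i hi (by linarith)]⟩

theorem exists_interval_of_not_min {ι : Type*} (E : Finset ι) (g : ι → ℚ)
    (hg : ∀ i ∈ E, ∀ j ∈ E, g i = g j → i = j) (c : ι → Prop)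
    (hno : ∀ i ∈ E, ∀ j ∈ E, ∀ k ∈ E, ∀ l ∈ E, c j → c l → ¬c i → ¬c k →
      ¬CycFour (g i) (g j) (g k) (g l))
    {m : ι} (hm : m ∈ E) (hmin : ∀ i ∈ E, g m ≤ g i) (hcm : ¬c m) {p : ι} (hp : p ∈ E)
    (hcp : c p) :
    ∃ y z : ℚ, y < z ∧ ∀ i ∈ E, g i ≠ y ∧ g i ≠ z ∧ (y < g i ∧ g i < z ↔ c i) := by
  classical
  have hne : (E.filter c).Nonempty := ⟨p, by simp [hp, hcp]⟩
  obtain ⟨lo, hlo, hlomin⟩ := Finset.exists_min_image _ g hne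
  obtain ⟨hi, hhi, hhimax⟩ := Finset.exists_max_image _ g hne
  simp only [Finset.mem_filter] at hlo hhi hlomin hhimax
  obtain ⟨y, hy, hyE⟩ := exists_lt_forall_lt E g (g lo)
  obtain ⟨z, hz, hzE⟩ := exists_gt_forall_gt E g (g hi)
  have hlohi := hlomin hi hhi
  refine ⟨y, z, by linarith, fun i hiE => ?_⟩
  rcases lt_or_ge (g i) (g lo) with h | h
  · have := hyE i hiE h
    grind
  rcases lt_or_ge (g hi) (g i) with h' | h'
  · have := hzE i hiE h'
    grind
  refine ⟨by grind, by grind, fun _ => ?_, fun _ => by grind⟩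
  by_contra hci
  have h₁ : g lo < g i := lt_of_le_of_ne h fun e => hci (hg _ hlo.1 _ hiE e ▸ hlo.2)
  have h₂ : g i < g hi := lt_of_le_of_ne h' fun e => hci (hg _ hhi.1 _ hiE e.symm ▸ hhi.2)
  have h₃ : g m < g lo := lt_of_le_of_ne (hmin lo hlo.1) fun e => hcm (hg _ hm _ hlo.1 e ▸ hlo.2)
  refine hno m hm lo hlo.1 i hiE hi hhi.1 hlo.2 hhi.2 hcm hci ?_
  unfold CycFour Cyc
  grind

/-- A two-colouring of finitely many points on a circle without alternating quadruples is cut out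
by a pair of points. -/
theorem exists_cut {ι : Type*} (E : Finset ι) (g : ι → ℚ)
    (hg : ∀ i ∈ E, ∀ j ∈ E, g i = g j → i = j) (c : ι → Prop)
    (hno : ∀ i ∈ E, ∀ j ∈ E, ∀ k ∈ E, ∀ l ∈ E, c i → c k → ¬c j → ¬c l →
      ¬CycFour (g i) (g j) (g k) (g l))
    {p q : ι} (hp : p ∈ E) (hcp : c p) (hq : q ∈ E) (hcq : ¬c q) :
    ∃ h t : ℚ, h ≠ t ∧ ∀ i ∈ E, g i ≠ h ∧ g i ≠ t ∧ (Cyc h (g i) t ↔ c i) := by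
  obtain ⟨m, hm, hmin⟩ := Finset.exists_min_image E g ⟨p, hp⟩
  by_cases hcm : c m
  · obtain ⟨y, z, hyz, h⟩ := exists_interval_of_not_min E g hg (fun i => ¬c i)
      (fun i hi j hj k hk l hl h₁ h₂ h₃ h₄ =>
        hno i hi j hj k hk l hl (not_not.1 h₃) (not_not.1 h₄) h₁ h₂)
      hm hmin (not_not.2 hcm) hq hcq
    refine ⟨z, y, hyz.ne', fun i hi => ⟨(h i hi).2.1, (h i hi).1, ?_⟩⟩
    have := h i hi
    unfold Cyc
    grind
  · obtain ⟨y, z, hyz, h⟩ := exists_interval_of_not_min E g hg c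
      (fun i hi j hj k hk l hl h₁ h₂ h₃ h₄ hf =>
        hno j hj k hk l hl i hi h₁ h₂ h₄ h₃ hf.rotate)
      hm hmin hcm hp hcp
    refine ⟨y, z, hyz.ne, fun i hi => ⟨(h i hi).1, (h i hi).2.1, ?_⟩⟩
    have := h i hi
    unfold Cyc
    grind

end Cut

section Diagram

variable {V : Type*} {α : Type*} [LinearOrder α]

open Classical in
/-- The side of the chord `v` on which the end `b` of the chord `w` lies (`b = true` being the
head), as prescribed by `β`; it is `0` on the clockwise arc from the head to the tail of `v`. -/
noncomputable def endSide (G : SimpleGraph V) (β : V → V → ZMod 2) (v w : V) (b : Bool) : ZMod 2 :=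
  if G.Adj v w ∧ b = false then β v w + 1 else β v w

/-- The points `f v true`, `f v false` are the heads and tails of an oriented chord diagram for
the subgraph induced on `S`, realizing `β`. -/
structure IsDiagram (G : SimpleGraph V) (β : V → V → ZMod 2) (S : Set V)
    (f : V → Bool → α) : Prop where
  inj : ∀ v ∈ S, ∀ w ∈ S, ∀ b c, f v b = f w c → v = w ∧ b = c
  side : ∀ v ∈ S, ∀ w ∈ S, v ≠ w → ∀ b,
    (Cyc (f v true) (f w b) (f v false) ↔ endSide G β v w b = 0)

theorem zmod_two_cases (a : ZMod 2) : a = 0 ∨ a = 1 := by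
  revert a; decide

theorem zmod_two_add_one_ne (a : ZMod 2) : a + 1 ≠ a := by
  revert a; decide

variable {G : SimpleGraph V} {β : V → V → ZMod 2}

@[simp] theorem endSide_true (v w : V) : endSide G β v w true = β v w := by simp [endSide]

theorem endSide_of_not_adj {v w : V} (h : ¬G.Adj v w) (b : Bool) :
    endSide G β v w b = β v w := by simp [endSide, h]

theorem endSide_false_of_adj {v w : V} (h : G.Adj v w) :
    endSide G β v w false = β v w + 1 := by simp [endSide, h]

theorem endSide_not_of_adj {v w : V} (h : G.Adj v w) (b : Bool) :
    endSide G β v w (!b) = endSide G β v w b + 1 := by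
  cases b
  · simp only [Bool.not_false, endSide_true, endSide_false_of_adj h]
    generalize β v w = a
    revert a; decide
  · simp [endSide_false_of_adj h]

/-- The end of the chord `u` that lies on the zero side of the chord `x` crossing it. -/
def zeroEnd (β : V → V → ZMod 2) (x u : V) : Bool := decide (β x u = 0)

theorem endSide_zeroEnd {x u : V} (h : G.Adj x u) : endSide G β x u (zeroEnd β x u) = 0 := by
  rcases zmod_two_cases (β x u) with h0 | h0
  · simp [zeroEnd, h0]
  · simp only [zeroEnd, h0, one_ne_zero, decide_false, endSide_false_of_adj h]
    decide

theorem endSide_zeroEnd_of_adj {v u : V} (x : V) (h : G.Adj v u) :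
    endSide G β v u (zeroEnd β x u) = β v u + β x u := by
  rcases zmod_two_cases (β x u) with h0 | h0
  · simp [zeroEnd, h0]
  · simp [zeroEnd, h0, endSide_false_of_adj h]

theorem eq_zeroEnd {x u : V} (h : G.Adj x u) {b : Bool} (hb : endSide G β x u b = 0) :
    b = zeroEnd β x u := by
  by_contra hne
  have : b = !zeroEnd β x u := by
    revert hne; generalize zeroEnd β x u = c; cases b <;> cases c <;> decide
  rw [this, endSide_not_of_adj h, endSide_zeroEnd h] at hb
  exact absurd hb (by decide)

theorem eq_not_zeroEnd {x u : V} (h : G.Adj x u) {b : Bool} (hb : endSide G β x u b ≠ 0) :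
    b = !zeroEnd β x u := by
  have : b ≠ zeroEnd β x u := fun e => hb (e ▸ endSide_zeroEnd h)
  revert this; generalize zeroEnd β x u = c; cases b <;> cases c <;> decide

namespace IsDiagram

variable {S : Set V} {f : V → Bool → α}

theorem ne (D : IsDiagram G β S f) {v w : V} (hv : v ∈ S) (hw : w ∈ S) (h : v ≠ w) (b c : Bool) :
    f v b ≠ f w c := fun e => h (D.inj v hv w hw b c e).1

theorem ne_not (D : IsDiagram G β S f) {v : V} (hv : v ∈ S) (b : Bool) :
    f v b ≠ f v !b := fun e => by
  have := (D.inj v hv v hv _ _ e).2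
  revert this; cases b <;> decide

theorem head_ne_tail (D : IsDiagram G β S f) {v : V} (hv : v ∈ S) : f v true ≠ f v false :=
  D.ne_not hv true

theorem cyc_zeroEnd (D : IsDiagram G β S f) (x : V) {u v : V} (hu : u ∈ S) (hv : v ∈ S)
    (huv : u ≠ v) (c : Bool) :
    Cyc (f u (zeroEnd β x u)) (f v c) (f u (!zeroEnd β x u)) ↔ endSide G β u v c + β x u = 0 := by
  rcases zmod_two_cases (β x u) with h0 | h0
  · simpa [zeroEnd, h0] using D.side u hu v hv huv c
  · simp only [zeroEnd, h0, one_ne_zero, decide_false, Bool.not_false]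
    rw [← not_cyc_iff (D.ne hu hv huv _ _) (D.ne hv hu huv.symm _ _) (D.head_ne_tail hu),
      D.side u hu v hv huv c]
    generalize endSide G β u v c = a
    revert a; decide

theorem cyc_zeroEnd_of_adj (D : IsDiagram G β S f) (x : V) {u v : V} (hu : u ∈ S) (hv : v ∈ S)
    (huv : G.Adj u v) :
    Cyc (f u (zeroEnd β x u)) (f v (zeroEnd β x v)) (f u (!zeroEnd β x u)) ↔
      β u v + β x u + β x v = 0 := by
  rw [D.cyc_zeroEnd x hu hv huv.ne, endSide_zeroEnd_of_adj x huv]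
  rw [add_right_comm]

/-- In a diagram of `K₄`, the three chords crossing `x` are seen from `x` in an acyclic order. -/
theorem not_cyclic (D : IsDiagram G β S f) {x a b c : V} (hx : x ∈ S) (ha : a ∈ S) (hb : b ∈ S)
    (hc : c ∈ S) (hxa : G.Adj x a) (hxb : G.Adj x b) (hxc : G.Adj x c) (hab : G.Adj a b)
    (hbc : G.Adj b c) (hca : G.Adj c a) :
    ¬(β a b + β x a + β x b = β b c + β x b + β x c ∧
      β b c + β x b + β x c = β c a + β x c + β x a) := by
  have hp : ∀ u ∈ S, G.Adj x u → Cyc (f x true) (f u (zeroEnd β x u)) (f x false) :=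
    fun u hu h => (D.side x hx u hu h.ne _).2 (endSide_zeroEnd h)
  have hq : ∀ u ∈ S, G.Adj x u → Cyc (f x false) (f u (!zeroEnd β x u)) (f x true) := by
    intro u hu h
    rw [← not_cyc_iff (D.ne hx hu h.ne _ _) (D.ne hu hx h.ne.symm _ _) (D.head_ne_tail hx),
      D.side x hx u hu h.ne, endSide_not_of_adj h, endSide_zeroEnd h]
    decide
  have := not_cyclic_of_transversal (hp a ha hxa) (hp b hb hxb) (hp c hc hxc) (hq a ha hxa)
    (hq b hb hxb) (hq c hc hxc) (D.ne ha hb hab.ne _ _) (D.ne ha hc hca.ne.symm _ _)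
  rw [D.cyc_zeroEnd_of_adj x ha hb hab, D.cyc_zeroEnd_of_adj x hb hc hbc,
    D.cyc_zeroEnd_of_adj x hc ha hca] at this
  rintro ⟨h₁, h₂⟩
  exact this ⟨by rw [h₁], by rw [h₂]⟩

/-- If, among three pairwise disjoint chords, `x` separates `u` from `w`, then `u` and `x` are on
the same side of `w`. -/
theorem eq_of_separates (D : IsDiagram G β S f) {x w u : V} (hx : x ∈ S) (hw : w ∈ S) (hu : u ∈ S)
    (hxw : x ≠ w) (hxu : x ≠ u) (hwu : w ≠ u) (nxw : ¬G.Adj x w) (nxu : ¬G.Adj x u)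
    (nwu : ¬G.Adj w u) (h : β x u ≠ β x w) : β w u = β w x := by
  have key : ∀ v ∈ S, ∀ z ∈ S, v ≠ z → ¬G.Adj v z → ∀ b,
      (Cyc (f v true) (f z b) (f v false) ↔ β v z = 0) := fun v hv z hz hvz nvz b => by
    rw [D.side v hv z hz hvz, endSide_of_not_adj nvz]
  have hd : [f x true, f x false, f w true, f w false, f u true, f u false].Nodup := by
    simp [D.ne hx hw hxw, D.ne hx hu hxu, D.ne hw hu hwu, D.head_ne_tail hx, D.head_ne_tail hw,
      D.head_ne_tail hu]
  have k₁ := key x hx u hu hxu nxu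
  have k₂ := key x hx w hw hxw nxw
  have k₃ := key w hw u hu hwu nwu
  have k₄ := key w hw x hx hxw.symm (fun e => nxw e.symm)
  have k₅ := key u hu x hx hxu.symm (fun e => nxu e.symm)
  have k₆ := key u hu w hw hwu.symm (fun e => nwu e.symm)
  have := cyc_of_three_disjoint hd (by rw [k₁, k₁]) (by rw [k₂, k₂]) (by rw [k₃, k₃])
    (by rw [k₄, k₄]) (by rw [k₅, k₅]) (by rw [k₆, k₆])
  rw [k₁, k₂, k₃, k₄] at this
  revert this h
  generalize β x u = a, β x w = b, β w u = c, β w x = d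
  revert a b c d
  decide

end IsDiagram

end Diagram

section Extension

variable {V : Type*} {G : SimpleGraph V} {β : V → V → ZMod 2}

/-- The condition on the claws of `G`: one leaf `x` separating the two others lies, as seen from
each of them, on the same side as the other. -/
def ClawCondition (G : SimpleGraph V) (β : V → V → ZMod 2) : Prop :=
  ∀ v x w u : V, x ≠ w → x ≠ u → w ≠ u → G.Adj v x → G.Adj v w → G.Adj v u →
    ¬G.Adj x w → ¬G.Adj x u → ¬G.Adj w u → β x u ≠ β x w → β w u = β w x

/-- The condition on the `K₄` subgraphs of `G`: the tournament which `β` puts on the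
neighbours of `x` after reorientation with respect to `x` has no directed triangle. -/
def CompleteCondition (G : SimpleGraph V) (β : V → V → ZMod 2) : Prop :=
  ∀ x a b c : V, G.Adj x a → G.Adj x b → G.Adj x c → G.Adj a b → G.Adj b c → G.Adj c a →
    ¬(β a b + β x a + β x b = β b c + β x b + β x c ∧
      β b c + β x b + β x c = β c a + β x c + β x a)

/-- Adjacency within `S`. -/
def AdjIn (G : SimpleGraph V) (S : Set V) (a b : V) : Prop :=
  G.Adj a b ∧ a ∈ S ∧ b ∈ S

namespace NajiSolution

theorem eq_of_adj (hβ : NajiSolution G β) {x v w : V} (hv : x ≠ v) (hw : x ≠ w) (h : G.Adj v w)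
    (nv : ¬G.Adj x v) (nw : ¬G.Adj x w) : β x v = β x w := by
  have := hβ.2.1 x v w hv hw h nv nw
  revert this; generalize β x v = a, β x w = b; revert a b; decide

theorem eq_of_separates (hβ : NajiSolution G β) (hclaw : ClawCondition G β) {S : Set V}
    {x w y u : V} (hxS : x ∉ S) (hwx : w ≠ x) (nxw : ¬G.Adj x w) (hxy : G.Adj x y)
    (hu : Relation.ReflTransGen (AdjIn G S) u y) (hux : u ≠ x) (nxu : ¬G.Adj x u)
    (h : β x u ≠ β x w) : β w u = β w x := by
  induction hu using Relation.ReflTransGen.head_induction_on with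
  | refl => exact absurd hxy nxu
  | @head u u' huu' _ ih =>
    obtain ⟨huu', -, hu'S⟩ := huu'
    have hu'x : u' ≠ x := fun e => hxS (e ▸ hu'S)
    have hwu : w ≠ u := fun e => h (by rw [e])
    have nwu : ¬G.Adj w u := fun e => h (hβ.eq_of_adj hux.symm hwx.symm e.symm nxu nxw)
    by_cases hxu' : G.Adj x u'
    · by_cases hwu' : G.Adj w u'
      · exact hclaw u' x w u hwx.symm hux.symm hwu hxu'.symm hwu'.symm huu'.symm nxw nxu nwu h
      · have hwu'' : w ≠ u' := fun e => nxw (e ▸ hxu')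
        rw [hβ.eq_of_adj hwu hwu'' huu' nwu hwu']
        exact hβ.eq_of_adj hwu'' hwx hxu'.symm hwu' (fun e => nxw e.symm)
    · have h' : β x u = β x u' := hβ.eq_of_adj hux.symm hu'x.symm huu' nxu hxu'
      have hwu'' : w ≠ u' := fun e => h (by rw [e, h'])
      have nwu' : ¬G.Adj w u' := fun e =>
        (h' ▸ h) (hβ.eq_of_adj hu'x.symm hwx.symm e.symm hxu' nxw)
      rw [hβ.eq_of_adj hwu hwu'' huu' nwu nwu']
      exact ih hu'x hxu' (h' ▸ h)

/-- All the ends lying on the other side of `x` than `w` are on the same side of `w` as `x`. -/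
theorem endSide_eq (hβ : NajiSolution G β) (hclaw : ClawCondition G β) {S : Set V} {x w y u : V}
    (hxS : x ∉ S) (hwx : w ≠ x) (nxw : ¬G.Adj x w) (hxy : G.Adj x y)
    (hu : Relation.ReflTransGen (AdjIn G S) u y) (hux : u ≠ x) (hwu : w ≠ u) {b : Bool}
    (h : endSide G β x u b ≠ β x w) : endSide G β w u b = β w x := by
  by_cases hxu : G.Adj x u
  · by_cases hadj : G.Adj w u
    · have h₁ := hβ.1 w u hadj
      have h₂ := hβ.1 x u hxu
      have h₃ := hβ.2.2 u x w hwx.symm hxu.symm hadj.symm nxw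
      cases b
      · rw [endSide_false_of_adj hxu] at h
        rw [endSide_false_of_adj hadj]
        revert h h₁ h₂ h₃
        generalize β x u = a, β u x = b, β w u = c, β u w = d, β x w = e, β w x = g
        revert a b c d e g; decide
      · rw [endSide_true] at h ⊢
        revert h h₁ h₂ h₃
        generalize β x u = a, β u x = b, β w u = c, β u w = d, β x w = e, β w x = g
        revert a b c d e g; decide
    · rw [endSide_of_not_adj hadj]
      exact hβ.eq_of_adj hwu hwx hxu.symm hadj (fun e => nxw e.symm)
  · rw [endSide_of_not_adj hxu] at h
    have hadj : ¬G.Adj w u := fun e => h (hβ.eq_of_adj hux.symm hwx.symm e.symm hxu nxw)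
    rw [endSide_of_not_adj hadj]
    exact hβ.eq_of_separates hclaw hxS hwx nxw hxy hu hux hxu h

variable {S : Set V} {α : Type*} [LinearOrder α] {f : V → Bool → α}

theorem exists_adj_end (hβ : NajiSolution G β) (hclaw : ClawCondition G β)
    (D : IsDiagram G β S f) {x y : V} (hxS : x ∉ S) (hyS : y ∈ S) (hxy : G.Adj x y)
    (hS : ∀ u ∈ S, Relation.ReflTransGen (AdjIn G S) u y) {v₁ v₂ : V} (h₁ : v₁ ∈ S) (h₂ : v₂ ∈ S)
    {b₁ b₂ : Bool} {c : ZMod 2} (hc₁ : endSide G β x v₁ b₁ ≠ c) (hc₂ : endSide G β x v₂ b₂ ≠ c)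
    {m : V} (hm : Relation.ReflTransGen (AdjIn G S) m y) (hmS : m ∈ S) {b : Bool}
    (hc : endSide G β x m b = c) (hcyc : Cyc (f v₂ b₂) (f m b) (f v₁ b₁)) :
    ∃ v ∈ S, G.Adj x v ∧ ∃ b, endSide G β x v b = c ∧ Cyc (f v₂ b₂) (f v b) (f v₁ b₁) := by
  induction hm using Relation.ReflTransGen.head_induction_on generalizing b with
  | refl => exact ⟨y, hyS, hxy, b, hc, hcyc⟩
  | @head m m' hmm' _ ih =>
    obtain ⟨hmm', -, hm'S⟩ := hmm'
    by_cases hxm : G.Adj x m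
    · exact ⟨m, hmS, hxm, b, hc, hcyc⟩
    have nex : ∀ {z}, z ∈ S → z ≠ x := fun hz e => hxS (e ▸ hz)
    rw [endSide_of_not_adj hxm] at hc
    have hne : ∀ {v : V} {b : Bool}, endSide G β x v b ≠ c → m ≠ v := fun h e => by
      rw [← e, endSide_of_not_adj hxm] at h
      exact h hc
    have hside : ∀ {v : V} {b : Bool}, v ∈ S → endSide G β x v b ≠ c →
        endSide G β m v b = β m x := fun hv h =>
      hβ.endSide_eq hclaw hxS (nex hmS) hxm hxy (hS _ hv) (nex hv) (hne h) (hc.symm ▸ h)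
    obtain ⟨b', hb'⟩ : ∃ b', endSide G β m m' b' ≠ β m x := by
      by_cases e : endSide G β m m' true = β m x
      · refine ⟨false, ?_⟩
        have := endSide_not_of_adj (β := β) hmm' true
        rw [Bool.not_true] at this
        rw [this, e]
        exact zmod_two_add_one_ne _
      · exact ⟨true, e⟩
    have hc' : endSide G β x m' b' = c := by
      by_contra e
      exact hb' (hside hm'S e)
    refine ih hm'S hc' (cyc_of_separated (h := f m true) (t := f m false) (m := f m b) ?_
      (D.ne hmS h₁ (hne hc₁) _ _) (D.ne hmS h₁ (hne hc₁) _ _) (D.ne hmS h₂ (hne hc₂) _ _)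
      (D.ne hmS h₂ (hne hc₂) _ _) (D.head_ne_tail hmS) (D.ne hm'S hmS hmm'.ne.symm _ _)
      (D.ne hm'S hmS hmm'.ne.symm _ _) ?_ ?_ hcyc)
    · cases b <;> simp
    · rw [D.side m hmS v₁ h₁ (hne hc₁), D.side m hmS v₂ h₂ (hne hc₂), hside h₁ hc₁, hside h₂ hc₂]
    · rw [D.side m hmS v₁ h₁ (hne hc₁), D.side m hmS m' hm'S hmm'.ne, hside h₁ hc₁]
      revert hb'
      generalize endSide G β m m' b' = p, β m x = q
      revert p q; decide

theorem cyc_zeroEnd_iff_not (hβ : NajiSolution G β) (D : IsDiagram G β S f) {x u v : V}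
    (hu : u ∈ S) (hv : v ∈ S) (huv : u ≠ v) (hxu : G.Adj x u) (hxv : G.Adj x v) :
    Cyc (f u (zeroEnd β x u)) (f v (zeroEnd β x v)) (f u (!zeroEnd β x u)) ↔
      ¬Cyc (f v (zeroEnd β x v)) (f u (zeroEnd β x u)) (f v (!zeroEnd β x v)) := by
  by_cases h : G.Adj u v
  · rw [D.cyc_zeroEnd_of_adj x hu hv h, D.cyc_zeroEnd_of_adj x hv hu h.symm]
    have := hβ.1 u v h
    revert this
    generalize β u v = a, β v u = b, β x u = c, β x v = d
    revert a b c d; decide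
  · rw [D.cyc_zeroEnd x hu hv huv, D.cyc_zeroEnd x hv hu huv.symm, endSide_of_not_adj h,
      endSide_of_not_adj fun e => h e.symm]
    have := hβ.2.2 x u v huv hxu hxv h
    revert this
    generalize β u v = a, β v u = b, β x u = c, β x v = d
    revert a b c d; decide

theorem not_cycFour_of_three (hβ : NajiSolution G β) (hK : CompleteCondition G β)
    (D : IsDiagram G β S f) {x a b c : V} (ha : a ∈ S) (hb : b ∈ S) (hc : c ∈ S)
    (hxa : G.Adj x a) (hxb : G.Adj x b) (hxc : G.Adj x c) (hab : a ≠ b) (hac : a ≠ c)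
    (hbc : b ≠ c) :
    ¬CycFour (f a (zeroEnd β x a)) (f a (!zeroEnd β x a)) (f b (zeroEnd β x b))
        (f c (!zeroEnd β x c)) ∧
      ¬CycFour (f a (zeroEnd β x a)) (f b (!zeroEnd β x b)) (f c (zeroEnd β x c))
        (f a (!zeroEnd β x a)) := by
  have hadj : ∀ u ∈ S, ∀ v ∈ S, u ≠ v →
      ¬(Cyc (f u (zeroEnd β x u)) (f v (zeroEnd β x v)) (f u (!zeroEnd β x u)) ↔
        Cyc (f u (zeroEnd β x u)) (f v (!zeroEnd β x v)) (f u (!zeroEnd β x u))) →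
      G.Adj u v := fun u hu v hv huv h => by
    by_contra e
    rw [D.cyc_zeroEnd x hu hv huv, D.cyc_zeroEnd x hu hv huv, endSide_of_not_adj e,
      endSide_of_not_adj e] at h
    exact h Iff.rfl
  refine three_chords_not_alternating (hβ.cyc_zeroEnd_iff_not D ha hb hab hxa hxb)
    (hβ.cyc_zeroEnd_iff_not D ha hc hac hxa hxc) (hβ.cyc_zeroEnd_iff_not D hb hc hbc hxb hxc)
    fun h₁ h₂ h₃ => ?_
  have aab := hadj a ha b hb hab h₁
  have aac := hadj a ha c hc hac h₂
  have abc := hadj b hb c hc hbc h₃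
  rw [D.cyc_zeroEnd_of_adj x ha hb aab, D.cyc_zeroEnd_of_adj x hb hc abc,
    D.cyc_zeroEnd_of_adj x hc ha aac.symm]
  rintro ⟨e₁, e₂⟩
  refine hK x a b c hxa hxb hxc aab abc aac.symm ?_
  revert e₁ e₂
  generalize β a b + β x a + β x b = p, β b c + β x b + β x c = q, β c a + β x c + β x a = r
  revert p q r; decide

theorem not_cycFour_zeroEnd (hβ : NajiSolution G β) (hK : CompleteCondition G β)
    (D : IsDiagram G β S f) {x a b c d : V} (ha : a ∈ S) (hb : b ∈ S) (hc : c ∈ S) (hd : d ∈ S)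
    (hxa : G.Adj x a) (hxb : G.Adj x b) (hxc : G.Adj x c) (hxd : G.Adj x d) :
    ¬CycFour (f a (zeroEnd β x a)) (f b (!zeroEnd β x b)) (f c (zeroEnd β x c))
        (f d (!zeroEnd β x d)) := by
  intro h
  have hac : a ≠ c := by
    rintro rfl
    have := h.1
    unfold Cyc at this
    grind
  have htwo := two_chords_not_alternating (hβ.cyc_zeroEnd_iff_not D ha hc hac hxa hxc)
  by_cases hq : Cyc (f a (zeroEnd β x a)) (f a (!zeroEnd β x a)) (f c (zeroEnd β x c))
  · have h' : CycFour (f a (zeroEnd β x a)) (f a (!zeroEnd β x a)) (f c (zeroEnd β x c))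
        (f d (!zeroEnd β x d)) := ⟨hq, h.2⟩
    have had : a ≠ d := by
      rintro rfl
      have := h.2
      unfold Cyc at this hq
      grind
    by_cases hcd : c = d
    · subst hcd
      exact htwo.1 h'
    · exact (hβ.not_cycFour_of_three hK D ha hc hd hxa hxc hxd hac had hcd).1 h'
  · have hab : a ≠ b := by
      rintro rfl
      exact hq h.1
    rw [not_cyc_iff (D.ne_not ha _) (D.ne ha hc hac _ _) (D.ne ha hc hac _ _)] at hq
    have h' : CycFour (f a (zeroEnd β x a)) (f b (!zeroEnd β x b)) (f c (zeroEnd β x c))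
        (f a (!zeroEnd β x a)) := ⟨h.1, hq⟩
    by_cases hbc : b = c
    · subst hbc
      exact htwo.2 h'
    · exact (hβ.not_cycFour_of_three hK D ha hb hc hxa hxb hxc hab hac hbc).2 h'

/-- The sides of `x` prescribed by `β` never alternate around a diagram of a connected vertex set
containing a neighbour of `x`. -/
theorem not_cycFour (hβ : NajiSolution G β) (hclaw : ClawCondition G β)
    (hK : CompleteCondition G β) (D : IsDiagram G β S f) {x y : V} (hxS : x ∉ S) (hyS : y ∈ S)
    (hxy : G.Adj x y) (hS : ∀ u ∈ S, Relation.ReflTransGen (AdjIn G S) u y) {v₁ v₂ v₃ v₄ : V}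
    (h₁ : v₁ ∈ S) (h₂ : v₂ ∈ S) (h₃ : v₃ ∈ S) (h₄ : v₄ ∈ S) {b₁ b₂ b₃ b₄ : Bool}
    (hc₁ : endSide G β x v₁ b₁ = 0) (hc₂ : endSide G β x v₂ b₂ = 1)
    (hc₃ : endSide G β x v₃ b₃ = 0) (hc₄ : endSide G β x v₄ b₄ = 1) :
    ¬CycFour (f v₁ b₁) (f v₂ b₂) (f v₃ b₃) (f v₄ b₄) := by
  intro h
  have h01 : (1 : ZMod 2) ≠ 0 := one_ne_zero
  obtain ⟨a, ha, hxa, ba, hca, h'⟩ := hβ.exists_adj_end hclaw D hxS hyS hxy hS h₂ h₄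
    (hc₂ ▸ h01) (hc₄ ▸ h01) (hS _ h₁) h₁ hc₁ h.cyc
  replace h := h.replace h'
  obtain ⟨b, hb, hxb, bb, hcb, h'⟩ := hβ.exists_adj_end hclaw D hxS hyS hxy hS h₃ ha
    (hc₃ ▸ h01.symm) (hca ▸ h01.symm) (hS _ h₂) h₂ hc₂ h.cyc
  replace h := h.replace h'
  obtain ⟨c, hc, hxc, bc, hcc, h'⟩ := hβ.exists_adj_end hclaw D hxS hyS hxy hS h₄ hb
    (hc₄ ▸ h01) (hcb ▸ h01) (hS _ h₃) h₃ hc₃ h.cyc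
  replace h := h.replace h'
  obtain ⟨d, hd, hxd, bd, hcd, h'⟩ := hβ.exists_adj_end hclaw D hxS hyS hxy hS ha hc
    (hca ▸ h01.symm) (hcc ▸ h01.symm) (hS _ h₄) h₄ hc₄ h.cyc
  replace h := h.replace h'
  rw [eq_zeroEnd hxa hca, eq_not_zeroEnd (β := β) (b := bb) hxb (hcb ▸ h01), eq_zeroEnd hxc hcc,
    eq_not_zeroEnd (β := β) (b := bd) hxd (hcd ▸ h01)] at h
  exact hβ.not_cycFour_zeroEnd hK D ha hb hc hd hxa hxb hxc hxd h

/-- A diagram of a connected vertex set extends to any vertex with a neighbour in that set. -/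
theorem exists_isDiagram_insert [Finite V] (hβ : NajiSolution G β) (hclaw : ClawCondition G β)
    (hK : CompleteCondition G β) {f : V → Bool → ℚ} (D : IsDiagram G β S f) {x y : V}
    (hxS : x ∉ S) (hyS : y ∈ S) (hxy : G.Adj x y)
    (hS : ∀ u ∈ S, Relation.ReflTransGen (AdjIn G S) u y) :
    ∃ f' : V → Bool → ℚ, IsDiagram G β (insert x S) f' := by
  classical
  have := Fintype.ofFinite V
  obtain ⟨h, t, hht, hcut⟩ := exists_cut
    ((Finset.univ : Finset (V × Bool)).filter fun e => e.1 ∈ S) (fun e => f e.1 e.2)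
    (fun i hi j hj e => by
      simp only [Finset.mem_filter, Finset.mem_univ, true_and] at hi hj
      exact Prod.ext_iff.2 (D.inj _ hi _ hj _ _ e))
    (fun e => endSide G β x e.1 e.2 = 0)
    (fun i hi j hj k hk l hl h₁ h₂ h₃ h₄ => by
      simp only [Finset.mem_filter, Finset.mem_univ, true_and] at hi hj hk hl
      exact hβ.not_cycFour hclaw hK D hxS hyS hxy hS hi hj hk hl h₁
        ((zmod_two_cases _).resolve_left h₃) h₂ ((zmod_two_cases _).resolve_left h₄))
    (p := (y, zeroEnd β x y)) (q := (y, !zeroEnd β x y)) (by simpa) (endSide_zeroEnd hxy)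
    (by simpa) (by
      rw [endSide_not_of_adj hxy, endSide_zeroEnd hxy]
      decide)
  replace hcut : ∀ u ∈ S, ∀ b,
      f u b ≠ h ∧ f u b ≠ t ∧ (Cyc h (f u b) t ↔ endSide G β x u b = 0) :=
    fun u hu b => hcut (u, b) (by simpa)
  have hx : ∀ u ∈ S, u ≠ x := fun u hu e => hxS (e ▸ hu)
  let f' : V → Bool → ℚ := fun v b => if v = x then (if b then h else t) else f v b
  have fx : ∀ b, f' x b = if b then h else t := fun b => by simp [f']
  have fS : ∀ u ∈ S, ∀ b, f' u b = f u b := fun u hu b => by simp [f', hx u hu]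
  have hside : ∀ u ∈ S, ∀ b, Cyc (f u true) (f' x b) (f u false) ↔ endSide G β u x b = 0 := by
    intro u hu b
    have hd : [f u true, f u false, h, t].Nodup := by
      simp [D.head_ne_tail hu, hcut u hu, hht]
    by_cases hxu : G.Adj x u
    · have h₁ := (hcut u hu true).2.2
      have h₂ := (hcut u hu false).2.2
      rw [endSide_true] at h₁
      rw [endSide_false_of_adj hxu] at h₂
      have h₃ := hβ.1 x u hxu
      have h₄ : (Cyc (f u true) h (f u false) ↔ ¬Cyc h (f u true) t) ∧
          (Cyc (f u true) t (f u false) ↔ Cyc h (f u true) t) := by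
        refine cyc_ends_of_crossing hd ?_
        rw [h₁, h₂]
        generalize β x u = a
        revert a; decide
      rw [h₁] at h₄
      cases b
      · rw [fx, endSide_false_of_adj hxu.symm, if_neg (by simp), h₄.2]
        revert h₃
        generalize β x u = a, β u x = b
        revert a b; decide
      · rw [fx, endSide_true, if_pos rfl, h₄.1]
        revert h₃
        generalize β x u = a, β u x = b
        revert a b; decide
    · obtain ⟨c, hc⟩ : ∃ c, endSide G β x y c ≠ β x u := by
        by_cases e : endSide G β x y true = β x u
        · refine ⟨!true, ?_⟩
          rw [endSide_not_of_adj hxy, e]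
          exact zmod_two_add_one_ne _
        · exact ⟨true, e⟩
      have huy : u ≠ y := fun e => hxu (e ▸ hxy)
      have h₁ := hβ.endSide_eq hclaw hxS (hx u hu) hxu hxy .refl (hx y hyS) huy hc
      have h₂ := (D.side u hu y hyS huy c)
      rw [h₁] at h₂
      have h₃ := cyc_two_ends hd (D.ne hyS hu huy.symm c _) (D.ne hyS hu huy.symm c _) (by
        rw [(hcut y hyS c).2.2, (hcut u hu true).2.2, endSide_true]
        revert hc
        generalize endSide G β x y c = p, β x u = q
        revert p q; decide) (by
        rw [(hcut u hu true).2.2, (hcut u hu false).2.2, endSide_of_not_adj hxu,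
          endSide_of_not_adj hxu])
      rw [h₂] at h₃
      rw [fx, endSide_of_not_adj fun e => hxu e.symm]
      cases b
      · exact h₃.2
      · exact h₃.1
  refine ⟨f', ⟨?_, ?_⟩⟩
  · rintro v (rfl | hv) w (rfl | hw) b c e
    · refine ⟨rfl, ?_⟩
      rw [fx, fx] at e
      cases b <;> cases c <;> simp [hht, hht.symm] at e ⊢
    · rw [fx, fS w hw] at e
      have := hcut w hw c
      split at e <;> simp_all
    · rw [fx, fS v hv] at e
      have := hcut v hv b
      split at e <;> simp_all
    · rw [fS v hv, fS w hw] at e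
      exact D.inj v hv w hw b c e
  · rintro v (rfl | hv) w (rfl | hw) hvw b
    · exact absurd rfl hvw
    · rw [fx, fx, fS w hw]
      exact (hcut w hw b).2.2
    · rw [fS v hv, fS v hv]
      exact hside v hv b
    · rw [fS v hv, fS v hv, fS w hw]
      exact D.side v hv w hw hvw b

theorem exists_isDiagram_univ [Finite V] (hβ : NajiSolution G β) (hclaw : ClawCondition G β)
    (hK : CompleteCondition G β) (hconn : G.Connected) :
    ∃ f : V → Bool → ℚ, IsDiagram G β Set.univ f := by
  classical
  obtain ⟨v₀⟩ := hconn.nonempty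
  let P : Set V → Prop := fun S => v₀ ∈ S ∧
    (∀ u ∈ S, ∀ w ∈ S, Relation.ReflTransGen (AdjIn G S) u w) ∧
    ∃ f : V → Bool → ℚ, IsDiagram G β S f
  have h₀ : P {v₀} := by
    refine ⟨rfl, ?_, fun _ b => if b then 1 else 0, ?_, ?_⟩
    · rintro u rfl w rfl
      exact .refl
    · rintro v rfl w rfl b c
      cases b <;> cases c <;> simp
    · rintro v rfl w rfl h
      exact absurd rfl h
  obtain ⟨S, hS⟩ := (Set.toFinite {S | P S}).exists_maximal ⟨_, h₀⟩
  obtain ⟨⟨hv₀, hpath, f, D⟩, hmax⟩ := hS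
  suffices S = Set.univ by
    subst this
    exact ⟨f, D⟩
  by_contra hne
  obtain ⟨z, hz⟩ := (Set.ne_univ_iff_exists_notMem S).1 hne
  obtain ⟨p⟩ := hconn.preconnected v₀ z
  obtain ⟨d, -, hy, hx⟩ := p.exists_boundary_dart S hv₀ hz
  have hxy := d.adj.symm
  generalize d.fst = y at *
  generalize d.snd = x at *
  obtain ⟨f', D'⟩ := hβ.exists_isDiagram_insert hclaw hK D hx hy hxy fun u hu => hpath u hu y hy
  have hmono : ∀ u ∈ S, ∀ w ∈ S, Relation.ReflTransGen (AdjIn G (insert x S)) u w :=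
    fun u hu w hw =>
      (hpath u hu w hw).lift id fun _ _ h => ⟨h.1, .inr h.2.1, .inr h.2.2⟩
  have hxy' : Relation.ReflTransGen (AdjIn G (insert x S)) x y :=
    .single ⟨hxy, .inl rfl, .inr hy⟩
  have hyx' : Relation.ReflTransGen (AdjIn G (insert x S)) y x :=
    .single ⟨hxy.symm, .inr hy, .inl rfl⟩
  refine hx (hmax (y := insert x S) ⟨.inr hv₀, ?_, f', D'⟩ (Set.subset_insert x S) (.inl rfl))
  rintro u (rfl | hu) w (rfl | hw)
  · exact .refl
  · exact hxy'.trans (hmono _ hy _ hw)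
  · exact (hmono _ hu _ hy).trans hyx'
  · exact hmono _ hu _ hw

end NajiSolution

end Extension

section OrientedChordDiagram

variable {V : Type*} [DecidableEq V] {G : SimpleGraph V} {β : V → V → ZMod 2}

theorem card_filter_eq_one_iff {ι : Type*} [Fintype ι] [DecidableEq ι] {p q : ι → Prop}
    [DecidablePred p] [DecidablePred q] {a b : ι} (hab : a ≠ b) (hp : ∀ k, p k ↔ k = a ∨ k = b) :
    (Finset.univ.filter fun k => p k ∧ q k).card = 1 ↔ ¬(q a ↔ q b) := by
  have : (Finset.univ.filter fun k => p k ∧ q k) = ({a, b} : Finset ι).filter q := by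
    ext k
    simp [hp]
  rw [this, Finset.filter_insert, Finset.filter_singleton]
  by_cases ha : q a <;> by_cases hb : q b <;> simp [ha, hb, hab]

theorem exists_separating_iff {m : ℕ} {word : Fin m → V} {pt : V → Bool → Fin m}
    (hend : Function.Injective2 pt) (hword : ∀ k v, word k = v ↔ ∃ b, k = pt v b) {u v : V}
    (huv : u ≠ v) :
    (∃ i j : Fin m, i < j ∧ word i = u ∧ word j = u ∧
      (Finset.univ.filter fun k => word k = v ∧ i < k ∧ k < j).card = 1) ↔
    ¬(Cyc (pt u true) (pt v true) (pt u false) ↔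
      Cyc (pt u true) (pt v false) (pt u false)) := by
  have hne : ∀ w, pt w true ≠ pt w false := fun w e => by simpa using (hend e).2
  have hne' : ∀ b c, pt v b ≠ pt u c := fun b c e => huv (hend e).1.symm
  have hcount : ∀ i j : Fin m,
      (Finset.univ.filter fun k => word k = v ∧ i < k ∧ k < j).card = 1 ↔
        ¬((i < pt v true ∧ pt v true < j) ↔ (i < pt v false ∧ pt v false < j)) :=
    fun i j => card_filter_eq_one_iff (hne v) fun k => by
      rw [hword, Bool.exists_bool, or_comm]
  have hlt : ∀ b c, pt u b < pt u c → _ := fun b c h =>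
    separated_iff_of_lt h (hne' true b) (hne' true c) (hne' false b) (hne' false c)
  constructor
  · rintro ⟨i, j, hij, hi, hj, h⟩
    rw [hcount] at h
    obtain ⟨b, rfl⟩ := (hword _ _).1 hi
    obtain ⟨c, rfl⟩ := (hword _ _).1 hj
    cases b <;> cases c
    · exact absurd hij (lt_irrefl _)
    · exact (hlt _ _ hij).2.1 h
    · exact (hlt _ _ hij).1.1 h
    · exact absurd hij (lt_irrefl _)
  · intro h
    rcases lt_or_gt_of_ne (hne u) with hu | hu
    · exact ⟨_, _, hu, (hword _ _).2 ⟨_, rfl⟩, (hword _ _).2 ⟨_, rfl⟩,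
        (hcount _ _).2 ((hlt _ _ hu).1.2 h)⟩
    · exact ⟨_, _, hu, (hword _ _).2 ⟨_, rfl⟩, (hword _ _).2 ⟨_, rfl⟩,
        (hcount _ _).2 ((hlt _ _ hu).2.2 h)⟩

variable [Fintype V]

theorem OCD.exists_ends (D : OCD G) : ∃ pt : V → Bool → Fin (2 * Fintype.card V),
    (∀ v b, D.word (pt v b) = v ∧ D.isHead (pt v b) = b) ∧
    ∀ k v, D.word k = v ↔ ∃ b, k = pt v b := by
  have h : ∀ v, ∃ e : Bool → Fin (2 * Fintype.card V),
      (∀ b, D.word (e b) = v ∧ D.isHead (e b) = b) ∧ ∀ k, D.word k = v ↔ ∃ b, k = e b := by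
    intro v
    obtain ⟨a, ha⟩ := Finset.card_eq_one.1 (D.head_one v)
    obtain ⟨p, q, hpq, h₂⟩ := Finset.card_eq_two.1 (D.occ_two v)
    have ha' : ∀ k, D.word k = v ∧ D.isHead k = true ↔ k = a := fun k => by
      simpa using Finset.ext_iff.1 ha k
    have h₂' : ∀ k, D.word k = v ↔ k = p ∨ k = q := fun k => by
      simpa using Finset.ext_iff.1 h₂ k
    obtain ⟨c, hac, hc⟩ : ∃ c, a ≠ c ∧ ∀ k, D.word k = v ↔ k = a ∨ k = c := by
      rcases (h₂' a).1 ((ha' a).2 rfl).1 with rfl | rfl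
      · exact ⟨q, hpq, h₂'⟩
      · exact ⟨p, hpq.symm, fun k => by rw [h₂', or_comm]⟩
    have hc' : D.isHead c = false := by
      by_contra e
      exact hac ((ha' c).1 ⟨(hc c).2 (.inr rfl), by simpa using e⟩).symm
    refine ⟨fun b => if b then a else c, ?_, fun k => by simp [hc, or_comm]⟩
    rintro (_ | _)
    · simpa [hc'] using (hc c).2 (.inr rfl)
    · simpa using (ha' a).2 rfl
  choose e he using h
  exact ⟨e, fun v => (he v).1, fun k v => (he v).2 k⟩

theorem NajiChordal.exists_isDiagram (h : NajiChordal G β) :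
    ∃ f : V → Bool → Fin (2 * Fintype.card V), IsDiagram G β Set.univ f := by
  obtain ⟨D, hD⟩ := h
  obtain ⟨e, he, hword⟩ := D.exists_ends
  have hinj : Function.Injective2 e := fun v w b c h =>
    ⟨by rw [← (he v b).1, h, (he w c).1], by rw [← (he v b).2, h, (he w c).2]⟩
  refine ⟨e, fun v _ w _ b c h => hinj h, fun v _ w _ hvw b => ?_⟩
  have h₁ : Cyc (e v true) (e w true) (e v false) ↔ β v w = 0 := by
    rw [hD v w hvw _ _ _ (he v true).1 (he v true).2 (he v false).1 (he v false).2
      (he w true).1 (he w true).2, cycBtw_iff_cyc fun h => by simpa using (hinj h).2]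
  cases b
  · have h₂ := D.adj_iff v w hvw
    rw [exists_separating_iff hinj hword hvw, h₁] at h₂
    by_cases hadj : G.Adj v w
    · rw [endSide_false_of_adj hadj]
      have := h₂.1 hadj
      rcases zmod_two_cases (β v w) with e | e <;>
        simp_all [show (1 : ZMod 2) + 1 = 0 from rfl]
    · rw [endSide_of_not_adj hadj]
      exact (not_not.1 fun h => hadj (h₂.2 h)).symm
  · rw [endSide_true, h₁]

theorem IsDiagram.najiChordal {f : V → Bool → ℚ} (D : IsDiagram G β Set.univ f) :
    NajiChordal G β := by
  have hf : Function.Injective fun p : V × Bool => f p.1 p.2 := fun p q h =>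
    Prod.ext_iff.2 (D.inj _ trivial _ trivial _ _ h)
  have hcard : (Finset.univ.image fun p : V × Bool => f p.1 p.2).card = 2 * Fintype.card V := by
    rw [Finset.card_image_of_injective _ hf, Finset.card_univ, Fintype.card_prod,
      Fintype.card_bool, mul_comm]
  let g := (Finset.univ.image fun p : V × Bool => f p.1 p.2).orderEmbOfFin hcard
  have hg : ∀ p : V × Bool, ∃ i, g i = f p.1 p.2 := fun p => by
    have : f p.1 p.2 ∈ Set.range g := by
      rw [Finset.range_orderEmbOfFin]
      simp
    exact this
  have hg' : ∀ i, ∃ p : V × Bool, f p.1 p.2 = g i := fun i => by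
    have := Finset.orderEmbOfFin_mem _ hcard i
    simpa only [Finset.mem_image, Finset.mem_univ, true_and] using this
  choose e he using hg
  choose r hr using hg'
  have hre : ∀ p, r (e p) = p := fun p => hf ((hr _).trans (he p))
  have her : ∀ i, e (r i) = i := fun i => g.injective ((he _).trans (hr i))
  have hinj : Function.Injective2 fun v b => e (v, b) := fun v w b c h =>
    Prod.ext_iff.1 (((hre (v, b)).symm.trans (congrArg r h)).trans (hre (w, c)))
  have hword : ∀ k v, (r k).1 = v ↔ ∃ b, k = e (v, b) := by
    refine fun k v => ⟨?_, ?_⟩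
    · rintro rfl
      exact ⟨(r k).2, (her k).symm⟩
    · rintro ⟨b, rfl⟩
      rw [hre]
  have hside : ∀ v w : V, v ≠ w → ∀ b,
      (Cyc (e (v, true)) (e (w, b)) (e (v, false)) ↔ endSide G β v w b = 0) :=
    fun v w hvw b => by
      rw [← D.side v trivial w trivial hvw b, ← cyc_map_iff g.strictMono, he, he, he]
  have hend : ∀ k v b, (r k).1 = v → (r k).2 = b → k = e (v, b) := by
    rintro k v b rfl rfl
    exact (her k).symm
  refine ⟨⟨fun i => (r i).1, fun i => (r i).2, fun v => ?_, fun v => ?_, fun u v huv => ?_⟩, ?_⟩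
  · rw [Finset.card_eq_two]
    refine ⟨e (v, true), e (v, false), fun h => by simpa using (hinj h).2, ?_⟩
    ext k
    simp [hword, or_comm]
  · rw [Finset.card_eq_one]
    refine ⟨e (v, true), ?_⟩
    ext k
    simp only [Finset.mem_filter, Finset.mem_univ, true_and, Finset.mem_singleton]
    exact ⟨fun h => hend _ _ _ h.1 h.2, by rintro rfl; simp [hre]⟩
  · rw [exists_separating_iff hinj hword huv, hside u v huv, hside u v huv]
    by_cases hadj : G.Adj u v
    · rw [endSide_false_of_adj hadj, endSide_true]
      generalize β u v = a
      rcases zmod_two_cases a with rfl | rfl <;>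
        simp [hadj, show (1 : ZMod 2) + 1 = 0 from rfl]
    · simp [endSide_of_not_adj hadj, hadj]
  · intro u v huv hu tu hv h₁ h₂ h₃ h₄ h₅ h₆
    rw [hend _ _ _ h₁ h₂, hend _ _ _ h₃ h₄, hend _ _ _ h₅ h₆,
      cycBtw_iff_cyc fun h => by simpa using (hinj h).2, hside u v huv, endSide_true]

end OrientedChordDiagram

section Restriction

variable {V : Type*} {G : SimpleGraph V}

theorem exists_embedding_clawGraph {v x w u : V} (hxw : x ≠ w) (hxu : x ≠ u) (hwu : w ≠ u)
    (hvx : G.Adj v x) (hvw : G.Adj v w) (hvu : G.Adj v u) (nxw : ¬G.Adj x w) (nxu : ¬G.Adj x u)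
    (nwu : ¬G.Adj w u) : ∃ φ : clawGraph ↪g G, ⇑φ = ![v, x, w, u] := by
  have h₁ := hvx.ne
  have h₂ := hvw.ne
  have h₃ := hvu.ne
  refine ⟨⟨⟨![v, x, w, u], ?_⟩, ?_⟩, rfl⟩
  · intro i j h
    fin_cases i <;> fin_cases j <;> simp_all
  · intro i j
    change G.Adj (![v, x, w, u] i) (![v, x, w, u] j) ↔ _
    fin_cases i <;> fin_cases j <;> simp_all [clawGraph, G.adj_comm]

theorem exists_embedding_top {x a b c : V} (hxa : G.Adj x a) (hxb : G.Adj x b) (hxc : G.Adj x c)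
    (hab : G.Adj a b) (hbc : G.Adj b c) (hca : G.Adj c a) :
    ∃ φ : (⊤ : SimpleGraph (Fin 4)) ↪g G, ⇑φ = ![x, a, b, c] := by
  have h₁ := hxa.ne
  have h₂ := hxb.ne
  have h₃ := hxc.ne
  have h₄ := hab.ne
  have h₅ := hbc.ne
  have h₆ := hca.ne
  refine ⟨⟨⟨![x, a, b, c], ?_⟩, ?_⟩, rfl⟩
  · intro i j h
    fin_cases i <;> fin_cases j <;> simp_all
  · intro i j
    change G.Adj (![x, a, b, c] i) (![x, a, b, c] j) ↔ _
    fin_cases i <;> fin_cases j <;> simp_all [G.adj_comm]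

variable [DecidableEq V] {β : V → V → ZMod 2}

theorem nonempty_induce_iso {W : Type*} [Fintype W] {H : SimpleGraph W} (φ : H ↪g G) :
    Nonempty (G.induce ((Finset.univ.image φ : Finset V) : Set V) ≃g H) := by
  have : ((Finset.univ.image φ : Finset V) : Set V) = Set.range φ := by simp
  rw [this]
  exact ⟨φ.isoInduceRange.symm⟩

theorem clawCondition_of_najiChordal
    (h : ∀ s : Finset V, Nonempty (G.induce (s : Set V) ≃g clawGraph) →
      NajiChordal (G.induce (s : Set V)) fun u v => β u.1 v.1) : ClawCondition G β := by
  intro v x w u hxw hxu hwu hvx hvw hvu nxw nxu nwu hne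
  obtain ⟨φ, hφ⟩ := exists_embedding_clawGraph hxw hxu hwu hvx hvw hvu nxw nxu nwu
  obtain ⟨f, D⟩ := (h _ (nonempty_induce_iso φ)).exists_isDiagram
  have hm : ∀ i, ![v, x, w, u] i ∈ ((Finset.univ.image φ : Finset V) : Set V) := fun i => by
    simp [← hφ]
  exact D.eq_of_separates (x := ⟨x, hm 1⟩) (w := ⟨w, hm 2⟩) (u := ⟨u, hm 3⟩) trivial trivial
    trivial (fun e => hxw (congrArg Subtype.val e)) (fun e => hxu (congrArg Subtype.val e))
    (fun e => hwu (congrArg Subtype.val e)) nxw nxu nwu hne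

theorem completeCondition_of_najiChordal
    (h : ∀ s : Finset V, Nonempty (G.induce (s : Set V) ≃g (⊤ : SimpleGraph (Fin 4))) →
      NajiChordal (G.induce (s : Set V)) fun u v => β u.1 v.1) : CompleteCondition G β := by
  intro x a b c hxa hxb hxc hab hbc hca
  obtain ⟨φ, hφ⟩ := exists_embedding_top hxa hxb hxc hab hbc hca
  obtain ⟨f, D⟩ := (h _ (nonempty_induce_iso φ)).exists_isDiagram
  have hm : ∀ i, ![x, a, b, c] i ∈ ((Finset.univ.image φ : Finset V) : Set V) := fun i => by
    simp [← hφ]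
  exact D.not_cyclic (x := ⟨x, hm 0⟩) (a := ⟨a, hm 1⟩) (b := ⟨b, hm 2⟩) (c := ⟨c, hm 3⟩) trivial
    trivial trivial trivial hxa hxb hxc hab hbc hca

end Restriction

/-- If `G` is connected and `β` is a non-chordal Naji solution, then some induced
subgraph of `G` isomorphic to `K₄` or to the claw carries a non-chordal
restriction of `β`. -/
theorem naji_obstruction_exists {V : Type*} [Fintype V] [DecidableEq V]
    (G : SimpleGraph V) (hconn : G.Connected) (β : V → V → ZMod 2)
    (hβ : NajiSolution G β) (hnc : ¬NajiChordal G β) :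
    ∃ s : Finset V,
      (Nonempty ((G.induce (s : Set V)) ≃g (⊤ : SimpleGraph (Fin 4))) ∨
        Nonempty ((G.induce (s : Set V)) ≃g clawGraph)) ∧
      ¬NajiChordal (G.induce (s : Set V)) (fun u v => β u.1 v.1) := by
  by_contra! hs
  have hclaw := clawCondition_of_najiChordal (β := β) fun s h => not_not.1 fun hn =>
    hn (hs s (.inr h))
  have hK := completeCondition_of_najiChordal (β := β) fun s h => not_not.1 fun hn =>
    hn (hs s (.inl h))
  obtain ⟨f, D⟩ := hβ.exists_isDiagram_univ hclaw hK hconn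
  exact hnc D.najiChordal
end

section
/- A finite simple graph G is a circle graph if and only if its Naji system has a solution, i.e., there exist β(u,v) ∈ 𝔽₂ for each ordered pair of distinct vertices such that: (1) β(v,w) + β(w,v) = 1 for each edge vw; (2) β(x,v) + β(x,w) = 0 for each triple (x,v,w) of distinct vertices with vw an edge and xv, xw non-edges; (3) β(v,w) + β(w,v) + β(x,v) + β(x,w) = 1 for each triple (x,v,w) of distinct vertices with xv, xw edges and vw a non-edge. -/
/-- `G` is a circle graph: there is a cyclic double occurrence word (each vertex
appearing exactly twice on a circle of `2n` positions) such that two vertices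
are adjacent iff their occurrences interleave. -/
def IsCircleGraph {V : Type*} [DecidableEq V] (G : SimpleGraph V) : Prop :=
  ∃ (n : ℕ) (w : Fin (2 * n) → V),
    (∀ v : V, (Finset.univ.filter fun i => w i = v).card = 2) ∧
    (∀ u v : V, u ≠ v →
      (G.Adj u v ↔ ∃ i j : Fin (2 * n), i < j ∧ w i = u ∧ w j = u ∧
        (Finset.univ.filter fun k => w k = v ∧ i < k ∧ k < j).card = 1))

section ChordGeometry

variable {L : Type*} [LinearOrder L]

/-- The truth value of `a < b` as an element of `𝔽₂`. -/
noncomputable def ltBit (a b : L) : ZMod 2 := if a < b then 1 else 0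

/-- Cut a circle at one point to get a linear order. `chordSide a b p` tells on which side of
the chord directed from `a` to `b` the point `p` lies: it is `1` when `p` lies on the cyclic
arc from `a` to `b`. -/
noncomputable def chordSide (a b p : L) : ZMod 2 :=
  ltBit a p + ltBit b p + ltBit b a

/-- Whether the chords `ab` and `cd` cross, as an element of `𝔽₂`. -/
noncomputable def chordCross (a b c d : L) : ZMod 2 :=
  ltBit a c + ltBit b c + ltBit a d + ltBit b d

theorem zmod_two_eq_zero_or_one (x : ZMod 2) : x = 0 ∨ x = 1 := by
  revert x; decide

theorem chordSide_target (a b c d : L) :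
    chordSide a b d = chordSide a b c + chordCross a b c d := by
  unfold chordCross chordSide
  grind

theorem chordCross_comm {a b c d : L} (hac : a ≠ c) (had : a ≠ d) (hbc : b ≠ c) (hbd : b ≠ d) :
    chordCross a b c d = chordCross c d a b := by
  unfold chordCross ltBit
  grind

theorem chordSide_add_of_cross {a b c d : L} (hac : a ≠ c) (had : a ≠ d)
    (h : chordCross a b c d = 1) : chordSide a b c + chordSide c d a = 1 := by
  unfold chordCross at h
  unfold chordSide
  unfold ltBit at *
  grind

theorem chordSide_eq_of_cross {x x' v v' w w' : L} (hvw : chordCross v v' w w' = 1)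
    (hxv : chordCross x x' v v' = 0) (hxw : chordCross x x' w w' = 0) :
    chordSide x x' v + chordSide x x' w = 0 := by
  unfold chordCross at *
  unfold chordSide
  unfold ltBit at *
  grind (splits := 40)

theorem chordSide_add_of_cross_of_cross {x x' v v' w w' : L} (hv : v ≠ w) (hv' : v ≠ w')
    (hvw : chordCross v v' w w' = 0) (hxv : chordCross x x' v v' = 1)
    (hxw : chordCross x x' w w' = 1) :
    chordSide v v' w + chordSide w w' v + chordSide x x' v + chordSide x x' w = 1 := by
  unfold chordCross at *
  unfold chordSide
  unfold ltBit at *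
  grind (splits := 40)

theorem chordSide_eq_or_eq_of_not_cross {a b c d : L} (hac : a ≠ c) (had : a ≠ d)
    (h : chordCross a b c d = 0) (p : L) :
    chordSide a b p = chordSide a b c ∨ chordSide c d p = chordSide c d a := by
  unfold chordCross at h
  unfold chordSide
  unfold ltBit at *
  grind

/-- A chord cannot separate four points on a circle in an alternating way. -/
theorem chordSide_not_alternating {a b p q r s : L} (hpq : p < q) (hqr : q < r) (hrs : r < s)
    (h₁ : chordSide a b p = chordSide a b r) (h₂ : chordSide a b q = chordSide a b s) :
    chordSide a b p = chordSide a b q := by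
  unfold chordSide at *
  unfold ltBit at *
  grind

/-- Of the three ways to split four points into two pairs, at most two are realized by chords. -/
theorem not_three_pairings {a a' b b' c c' p q r s : L}
    (hpqa : chordSide a a' p = chordSide a a' q) (hrsa : chordSide a a' r = chordSide a a' s)
    (hpra : chordSide a a' p ≠ chordSide a a' r)
    (hprb : chordSide b b' p = chordSide b b' r) (hqsb : chordSide b b' q = chordSide b b' s)
    (hpqb : chordSide b b' p ≠ chordSide b b' q)
    (hpsc : chordSide c c' p = chordSide c c' s) (hqrc : chordSide c c' q = chordSide c c' r)
    (hpqc : chordSide c c' p ≠ chordSide c c' q) : False := by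
  have key := fun (x y : L) => @chordSide_not_alternating L _ x y
  have hpq : p ≠ q := by rintro rfl; exact hpqb rfl
  have hpr : p ≠ r := by rintro rfl; exact hpra rfl
  have hps : p ≠ s := by rintro rfl; exact hpqb hqsb.symm
  have hqr : q ≠ r := by rintro rfl; exact hpqb hprb
  have hqs : q ≠ s := by rintro rfl; exact hpqc hpsc
  have hrs : r ≠ s := by rintro rfl; exact hpqb (hprb.trans hqsb.symm)
  rcases lt_or_gt_of_ne hpq with h1 | h1 <;> rcases lt_or_gt_of_ne hpr with h2 | h2 <;>
  rcases lt_or_gt_of_ne hps with h3 | h3 <;> rcases lt_or_gt_of_ne hqr with h4 | h4 <;>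
  rcases lt_or_gt_of_ne hqs with h5 | h5 <;> rcases lt_or_gt_of_ne hrs with h6 | h6 <;>
  first
  | order
  | grind

end ChordGeometry

section ChordModel

variable {V : Type*} {L : Type*} [LinearOrder L]

open Classical in
/-- The entry of the adjacency matrix of `G` over `𝔽₂`. -/
noncomputable def adjBit (G : SimpleGraph V) (u v : V) : ZMod 2 := if G.Adj u v then 1 else 0

theorem adjBit_eq_one {G : SimpleGraph V} {u v : V} : adjBit G u v = 1 ↔ G.Adj u v := by
  unfold adjBit; split_ifs with h <;> simp [h]

theorem adjBit_eq_zero {G : SimpleGraph V} {u v : V} : adjBit G u v = 0 ↔ ¬G.Adj u v := by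
  unfold adjBit; split_ifs with h <;> simp [h]

theorem adjBit_comm (G : SimpleGraph V) (u v : V) : adjBit G u v = adjBit G v u := by
  classical
  exact if_congr (G.adj_comm u v) rfl rfl

/-- The chords with endpoints `s v` and `t v`, for `v ∈ W`, represent the subgraph of `G` induced
by `W` as a circle graph. -/
structure ChordModel (G : SimpleGraph V) (W : Set V) (s t : V → L) : Prop where
  source_ne_target : ∀ u ∈ W, ∀ v ∈ W, s u ≠ t v
  source_ne : ∀ u ∈ W, ∀ v ∈ W, u ≠ v → s u ≠ s v
  target_ne : ∀ u ∈ W, ∀ v ∈ W, u ≠ v → t u ≠ t v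
  cross : ∀ u ∈ W, ∀ v ∈ W, u ≠ v → chordCross (s u) (t u) (s v) (t v) = adjBit G u v

namespace ChordModel

variable {G : SimpleGraph V} {W : Set V} {s t : V → L}

theorem target_ne_source (h : ChordModel G W s t) {u v : V} (hu : u ∈ W) (hv : v ∈ W) :
    t u ≠ s v := (h.source_ne_target v hv u hu).symm

theorem side_add_of_adj (h : ChordModel G W s t) {v w : V} (hv : v ∈ W) (hw : w ∈ W)
    (hvw : G.Adj v w) :
    chordSide (s v) (t v) (s w) + chordSide (s w) (t w) (s v) = 1 :=
  chordSide_add_of_cross (h.source_ne v hv w hw hvw.ne) (h.source_ne_target v hv w hw)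
    ((h.cross v hv w hw hvw.ne).trans (adjBit_eq_one.2 hvw))

theorem side_eq_of_adj (h : ChordModel G W s t) {x v w : V} (hx : x ∈ W) (hv : v ∈ W)
    (hw : w ∈ W) (hxv' : x ≠ v) (hxw' : x ≠ w) (hvw : G.Adj v w) (hxv : ¬G.Adj x v)
    (hxw : ¬G.Adj x w) :
    chordSide (s x) (t x) (s v) + chordSide (s x) (t x) (s w) = 0 :=
  chordSide_eq_of_cross ((h.cross v hv w hw hvw.ne).trans (adjBit_eq_one.2 hvw))
    ((h.cross x hx v hv hxv').trans (adjBit_eq_zero.2 hxv))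
    ((h.cross x hx w hw hxw').trans (adjBit_eq_zero.2 hxw))

theorem side_add_of_adj_of_adj (h : ChordModel G W s t) {x v w : V} (hx : x ∈ W) (hv : v ∈ W)
    (hw : w ∈ W) (hvw' : v ≠ w) (hxv : G.Adj x v) (hxw : G.Adj x w) (hvw : ¬G.Adj v w) :
    chordSide (s v) (t v) (s w) + chordSide (s w) (t w) (s v) +
      chordSide (s x) (t x) (s v) + chordSide (s x) (t x) (s w) = 1 :=
  chordSide_add_of_cross_of_cross (h.source_ne v hv w hw hvw') (h.source_ne_target v hv w hw)
    ((h.cross v hv w hw hvw').trans (adjBit_eq_zero.2 hvw))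
    ((h.cross x hx v hv hxv.ne).trans (adjBit_eq_one.2 hxv))
    ((h.cross x hx w hw hxw.ne).trans (adjBit_eq_one.2 hxw))

/-- Directing the chords of a chord model yields a solution to the Naji system. -/
theorem najiSolution (h : ChordModel G Set.univ s t) :
    NajiSolution G fun u v => chordSide (s u) (t u) (s v) :=
  ⟨fun _ _ hvw => h.side_add_of_adj trivial trivial hvw,
    fun _ _ _ hxv' hxw' hvw hxv hxw =>
      h.side_eq_of_adj trivial trivial trivial hxv' hxw' hvw hxv hxw,
    fun _ _ _ hvw' hxv hxw hvw =>
      h.side_add_of_adj_of_adj trivial trivial trivial hvw' hxv hxw hvw⟩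

end ChordModel

end ChordModel

section Words

variable {V : Type*} [DecidableEq V]

theorem exists_interleave_iff_chordCross {m : ℕ} {w : Fin m → V} {u v : V} {a b c d : Fin m}
    (hu : ∀ i, w i = u ↔ i = a ∨ i = b) (hv : ∀ i, w i = v ↔ i = c ∨ i = d)
    (hab : a ≠ b) (hcd : c ≠ d) (huv : u ≠ v) :
    (∃ i j : Fin m, i < j ∧ w i = u ∧ w j = u ∧
      (Finset.univ.filter fun k => w k = v ∧ i < k ∧ k < j).card = 1) ↔
      chordCross a b c d = 1 := by
  have hcard : ∀ i j : Fin m, (Finset.univ.filter fun k => w k = v ∧ i < k ∧ k < j).card =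
      (if i < c ∧ c < j then 1 else 0) + if i < d ∧ d < j then 1 else 0 := by
    intro i j
    have : (Finset.univ.filter fun k => w k = v ∧ i < k ∧ k < j) =
        ({c, d} : Finset (Fin m)).filter fun k => i < k ∧ k < j := by
      ext k
      simp [hv]
    rw [this, Finset.card_filter, Finset.sum_pair hcd]
  have hac : a ≠ c := by
    rintro rfl; exact huv (((hu a).2 (.inl rfl)).symm.trans ((hv a).2 (.inl rfl)))
  have had : a ≠ d := by
    rintro rfl; exact huv (((hu a).2 (.inl rfl)).symm.trans ((hv a).2 (.inr rfl)))
  have hbc : b ≠ c := by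
    rintro rfl; exact huv (((hu b).2 (.inr rfl)).symm.trans ((hv b).2 (.inl rfl)))
  have hbd : b ≠ d := by
    rintro rfl; exact huv (((hu b).2 (.inr rfl)).symm.trans ((hv b).2 (.inr rfl)))
  simp only [hcard, hu]
  constructor
  · rintro ⟨i, j, hij, hi, hj, h⟩
    unfold chordCross ltBit
    rcases hi with rfl | rfl <;> rcases hj with rfl | rfl <;> grind
  · intro h
    unfold chordCross ltBit at h
    rcases lt_or_gt_of_ne hab with hab | hab
    · exact ⟨a, b, hab, .inl rfl, .inr rfl, by grind⟩
    · exact ⟨b, a, hab, .inr rfl, .inl rfl, by grind⟩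

theorem IsCircleGraph.exists_chordModel {G : SimpleGraph V} (h : IsCircleGraph G) :
    ∃ s t : V → ℚ, ChordModel G Set.univ s t := by
  obtain ⟨n, w, h2, hadj⟩ := h
  have hex : ∀ v, ∃ a b : Fin (2 * n), a ≠ b ∧ ∀ i, w i = v ↔ i = a ∨ i = b := by
    intro v
    obtain ⟨a, b, hab, he⟩ := Finset.card_eq_two.1 (h2 v)
    refine ⟨a, b, hab, fun i => ?_⟩
    have := congrArg (i ∈ ·) he
    simpa using this
  choose a b hab hw using hex
  have hcast : ∀ i j : Fin (2 * n), ltBit ((i : ℕ) : ℚ) ((j : ℕ) : ℚ) = ltBit i j := by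
    intro i j; simp [ltBit]
  have hwa : ∀ v, w (a v) = v := fun v => (hw v _).2 (.inl rfl)
  have hwb : ∀ v, w (b v) = v := fun v => (hw v _).2 (.inr rfl)
  refine ⟨fun v => ((a v : ℕ) : ℚ), fun v => ((b v : ℕ) : ℚ), ⟨?_, ?_, ?_, ?_⟩⟩
  · intro u _ v _ h
    have h : a u = b v := by simpa [Fin.ext_iff] using h
    obtain rfl : u = v := by rw [← hwa u, h, hwb]
    exact hab u h
  · intro u _ v _ huv h
    have h : a u = a v := by simpa [Fin.ext_iff] using h
    exact huv (by rw [← hwa u, h, hwa])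
  · intro u _ v _ huv h
    have h : b u = b v := by simpa [Fin.ext_iff] using h
    exact huv (by rw [← hwb u, h, hwb])
  · intro u _ v _ huv
    have key := (hadj u v huv).trans
      (exists_interleave_iff_chordCross (hw u) (hw v) (hab u) (hab v) huv)
    have : chordCross ((a u : ℕ) : ℚ) ((b u : ℕ) : ℚ) ((a v : ℕ) : ℚ) ((b v : ℕ) : ℚ) =
        chordCross (a u) (b u) (a v) (b v) := by
      simp only [chordCross, hcast]
    rw [this]
    by_cases hG : G.Adj u v
    · rw [key.1 hG, adjBit_eq_one.2 hG]
    · rw [adjBit_eq_zero.2 hG]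
      exact (zmod_two_eq_zero_or_one _).resolve_right fun h => hG (key.2 h)

theorem ChordModel.isCircleGraph [Fintype V] {L : Type*} [LinearOrder L] {G : SimpleGraph V}
    {s t : V → L} (h : ChordModel G Set.univ s t) : IsCircleGraph G := by
  let f : V × Bool → L := fun p => bif p.2 then t p.1 else s p.1
  have hf : Function.Injective f := by
    rintro ⟨u, i⟩ ⟨v, j⟩ hij
    cases i <;> cases j <;> simp only [f, cond_true, cond_false] at hij
    · by_contra hne
      exact h.source_ne u trivial v trivial (fun e => hne (by rw [e])) hij
    · exact absurd hij (h.source_ne_target u trivial v trivial)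
    · exact absurd hij (h.target_ne_source trivial trivial)
    · by_contra hne
      exact h.target_ne u trivial v trivial (fun e => hne (by rw [e])) hij
  let _ : LinearOrder (V × Bool) := LinearOrder.lift' f hf
  have hcard : Fintype.card (V × Bool) = 2 * Fintype.card V := by
    rw [Fintype.card_prod, Fintype.card_bool, mul_comm]
  let e : Fin (2 * Fintype.card V) ≃o V × Bool := Fintype.orderIsoFinOfCardEq (V × Bool) hcard
  have hlt : ∀ p q, ltBit (e.symm p) (e.symm q) = ltBit (f p) (f q) := by
    intro p q
    simp only [ltBit, e.symm.lt_iff_lt]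
    rfl
  have hw : ∀ v i, (e i).1 = v ↔ i = e.symm (v, false) ∨ i = e.symm (v, true) := by
    intro v i
    rw [OrderIso.eq_symm_apply, OrderIso.eq_symm_apply]
    rcases e i with ⟨x, b⟩
    cases b <;> simp
  have hne : ∀ v, e.symm (v, false) ≠ e.symm (v, true) := by
    intro v hv
    simpa using e.symm.injective hv
  refine ⟨Fintype.card V, fun i => (e i).1, fun v => ?_, fun u v huv => ?_⟩
  · have : (Finset.univ.filter fun i => (e i).1 = v) =
        {e.symm (v, false), e.symm (v, true)} := by
      ext i; simp [hw]
    rw [this, Finset.card_pair (hne v)]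
  · rw [exists_interleave_iff_chordCross (hw u) (hw v) (hne u) (hne v) huv]
    have := h.cross u trivial v trivial huv
    simp only [chordCross, hlt, f, cond_true, cond_false] at this ⊢
    rw [this, adjBit_eq_one]

end Words

section Gluing

variable {V : Type*}

/-- The bipartite graph between `X` and its complement is complete bipartite up to isolated
vertices, that is, the cut-rank of `X` is at most one. -/
def CutRankLeOne (G : SimpleGraph V) (X : Set V) : Prop :=
  ∀ x ∈ X, ∀ x' ∈ X, ∀ y ∉ X, ∀ y' ∉ X, G.Adj x y → G.Adj x' y' → G.Adj x y'

theorem IsCircleGraph.exists_chordModel_of_induce [DecidableEq V] {G : SimpleGraph V} {W : Set V}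
    (h : IsCircleGraph (G.induce W)) : ∃ s t : V → ℚ, ChordModel G W s t := by
  classical
  obtain ⟨s, t, h⟩ := h.exists_chordModel
  refine ⟨fun v => if hv : v ∈ W then s ⟨v, hv⟩ else 0,
    fun v => if hv : v ∈ W then t ⟨v, hv⟩ else 0, ⟨?_, ?_, ?_, ?_⟩⟩
  · intro u hu v hv
    simpa [hu, hv] using h.source_ne_target ⟨u, hu⟩ trivial ⟨v, hv⟩ trivial
  · intro u hu v hv huv
    simpa [hu, hv] using h.source_ne ⟨u, hu⟩ trivial ⟨v, hv⟩ trivial (by simpa using huv)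
  · intro u hu v hv huv
    simpa [hu, hv] using h.target_ne ⟨u, hu⟩ trivial ⟨v, hv⟩ trivial (by simpa using huv)
  · intro u hu v hv huv
    simpa [hu, hv, adjBit] using h.cross ⟨u, hu⟩ trivial ⟨v, hv⟩ trivial (by simpa using huv)

theorem ChordModel.exists_union {G : SimpleGraph V} {X : Set V} {s₁ t₁ s₂ t₂ : V → ℚ}
    (h₁ : ChordModel G X s₁ t₁) (h₂ : ChordModel G Xᶜ s₂ t₂)
    (hX : ∀ x ∈ X, ∀ y ∉ X, ¬G.Adj x y) :
    ∃ s t : V → ℕ ×ₗ ℚ, ChordModel G Set.univ s t := by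
  classical
  refine ⟨fun v => if v ∈ X then toLex (0, s₁ v) else toLex (1, s₂ v),
    fun v => if v ∈ X then toLex (0, t₁ v) else toLex (1, t₂ v), ⟨?_, ?_, ?_, ?_⟩⟩
  · intro u _ v _
    by_cases hu : u ∈ X <;> by_cases hv : v ∈ X <;> simp only [hu, hv, if_true, if_false]
    · simpa using h₁.source_ne_target u hu v hv
    · simp
    · simp
    · simpa using h₂.source_ne_target u hu v hv
  · intro u _ v _ huv
    by_cases hu : u ∈ X <;> by_cases hv : v ∈ X <;> simp only [hu, hv, if_true, if_false]
    · simpa using h₁.source_ne u hu v hv huv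
    · simp
    · simp
    · simpa using h₂.source_ne u hu v hv huv
  · intro u _ v _ huv
    by_cases hu : u ∈ X <;> by_cases hv : v ∈ X <;> simp only [hu, hv, if_true, if_false]
    · simpa using h₁.target_ne u hu v hv huv
    · simp
    · simp
    · simpa using h₂.target_ne u hu v hv huv
  · intro u _ v _ huv
    by_cases hu : u ∈ X <;> by_cases hv : v ∈ X <;> simp only [hu, hv, if_true, if_false]
    · simpa [chordCross, ltBit, Prod.Lex.toLex_lt_toLex] using h₁.cross u hu v hv huv
    · rw [adjBit_eq_zero.2 (hX u hu v hv)]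
      simp [chordCross, ltBit, Prod.Lex.toLex_lt_toLex]
      decide
    · rw [adjBit_eq_zero.2 fun h => hX v hv u hu h.symm]
      simp [chordCross, ltBit, Prod.Lex.toLex_lt_toLex]
    · simpa [chordCross, ltBit, Prod.Lex.toLex_lt_toLex] using h₂.cross u hu v hv huv

/-- Label a point with `i`, `j` or `k` if it comes before, between or after the endpoints
`a` and `b` of a chord. -/
noncomputable def chordBlock (a b : ℚ) (i j k : ℕ) (p : ℚ) : ℕ ×ₗ ℚ :=
  toLex (if p < min a b then i else if p < max a b then j else k, p)

theorem ltBit_chordBlock (a b : ℚ) {i j k : ℕ} (hjk : j < k) (hki : k < i) (p q : ℚ) :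
    ltBit (chordBlock a b i j k p) (chordBlock a b i j k q) =
      ltBit p q + ltBit p (min a b) + ltBit q (min a b) := by
  unfold chordBlock
  simp only [ltBit, Prod.Lex.toLex_lt_toLex]
  grind

theorem chordCross_chordBlock (a b : ℚ) {i j k : ℕ} (hjk : j < k) (hki : k < i) (c d e f : ℚ) :
    chordCross (chordBlock a b i j k c) (chordBlock a b i j k d) (chordBlock a b i j k e)
      (chordBlock a b i j k f) = chordCross c d e f := by
  simp only [chordCross, ltBit_chordBlock a b hjk hki]
  grind

theorem ltBit_chordBlock_chordBlock (a b a' b' : ℚ) {p q : ℚ} (hpa : p ≠ a) (hpb : p ≠ b)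
    (hqa : q ≠ a') (hqb : q ≠ b') :
    ltBit (chordBlock a b 3 0 2 p) (chordBlock a' b' 5 1 4 q) =
      1 + (1 + ltBit a p + ltBit b p) * (ltBit a' q + ltBit b' q) := by
  unfold chordBlock
  simp only [ltBit, Prod.Lex.toLex_lt_toLex]
  grind

theorem chordCross_chordBlock_chordBlock (a b a' b' : ℚ) {p q p' q' : ℚ} (hpa : p ≠ a)
    (hpb : p ≠ b) (hqa : q ≠ a) (hqb : q ≠ b) (hpa' : p' ≠ a') (hpb' : p' ≠ b') (hqa' : q' ≠ a')
    (hqb' : q' ≠ b') :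
    chordCross (chordBlock a b 3 0 2 p) (chordBlock a b 3 0 2 q) (chordBlock a' b' 5 1 4 p')
      (chordBlock a' b' 5 1 4 q') = chordCross a b p q * chordCross a' b' p' q' := by
  unfold chordCross
  rw [ltBit_chordBlock_chordBlock a b a' b' hpa hpb hpa' hpb',
    ltBit_chordBlock_chordBlock a b a' b' hpa hpb hqa' hqb',
    ltBit_chordBlock_chordBlock a b a' b' hqa hqb hpa' hpb',
    ltBit_chordBlock_chordBlock a b a' b' hqa hqb hqa' hqb']
  grind

theorem chordBlock_injective (a b : ℚ) (i j k : ℕ) :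
    Function.Injective (chordBlock a b i j k) := by
  intro p q h
  simp only [chordBlock, toLex_inj, Prod.mk.injEq] at h
  exact h.2

theorem chordBlock_ne_chordBlock (a b a' b' p q : ℚ) :
    chordBlock a b 3 0 2 p ≠ chordBlock a' b' 5 1 4 q := by
  intro h
  simp only [chordBlock, toLex_inj, Prod.mk.injEq] at h
  grind

theorem ChordModel.exists_glue {G : SimpleGraph V} {X : Set V} {s₁ t₁ s₂ t₂ : V → ℚ} {x y : V}
    (hx : x ∈ X) (hy : y ∉ X) (hxy : G.Adj x y) (hX : CutRankLeOne G X)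
    (h₁ : ChordModel G (insert y X) s₁ t₁) (h₂ : ChordModel G (insert x Xᶜ) s₂ t₂) :
    ∃ s t : V → ℕ ×ₗ ℚ, ChordModel G Set.univ s t := by
  classical
  let B₁ := chordBlock (s₁ y) (t₁ y) 3 0 2
  let B₂ := chordBlock (s₂ x) (t₂ x) 5 1 4
  have hB₁ : Function.Injective B₁ := chordBlock_injective _ _ _ _ _
  have hB₂ : Function.Injective B₂ := chordBlock_injective _ _ _ _ _
  have hB : ∀ p q, B₁ p ≠ B₂ q := chordBlock_ne_chordBlock _ _ _ _
  have m₁ : ∀ {u}, u ∈ X → u ∈ insert y X := fun h => Set.mem_insert_of_mem _ h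
  have m₂ : ∀ {u}, u ∉ X → u ∈ insert x Xᶜ := fun h => Set.mem_insert_of_mem _ h
  have hmix : ∀ u ∈ X, ∀ v ∉ X,
      chordCross (B₁ (s₁ u)) (B₁ (t₁ u)) (B₂ (s₂ v)) (B₂ (t₂ v)) = adjBit G u v := by
    intro u hu v hv
    have huy : u ≠ y := by rintro rfl; exact hy hu
    have hvx : v ≠ x := by rintro rfl; exact hv hx
    have hy' : y ∈ insert y X := Set.mem_insert _ _
    have hx' : x ∈ insert x Xᶜ := Set.mem_insert _ _
    rw [chordCross_chordBlock_chordBlock _ _ _ _ (h₁.source_ne u (m₁ hu) y hy' huy)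
      (h₁.source_ne_target u (m₁ hu) y hy') (h₁.target_ne_source (m₁ hu) hy')
      (h₁.target_ne u (m₁ hu) y hy' huy) (h₂.source_ne v (m₂ hv) x hx' hvx)
      (h₂.source_ne_target v (m₂ hv) x hx') (h₂.target_ne_source (m₂ hv) hx')
      (h₂.target_ne v (m₂ hv) x hx' hvx), h₁.cross y hy' u (m₁ hu) huy.symm,
      h₂.cross x hx' v (m₂ hv) hvx.symm]
    by_cases huv : G.Adj u v
    · rw [adjBit_eq_one.2 huv, adjBit_eq_one.2 (hX x hx u hu y hy v hv hxy huv),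
        adjBit_eq_one.2 (hX u hu x hx v hv y hy huv hxy).symm, one_mul]
    · rw [adjBit_eq_zero.2 huv]
      by_cases hyu : G.Adj y u
      · rw [adjBit_eq_zero.2 fun hxv => huv (hX u hu x hx y hy v hv hyu.symm hxv), mul_zero]
      · rw [adjBit_eq_zero.2 hyu, zero_mul]
  refine ⟨fun v => if v ∈ X then B₁ (s₁ v) else B₂ (s₂ v),
    fun v => if v ∈ X then B₁ (t₁ v) else B₂ (t₂ v), ⟨?_, ?_, ?_, ?_⟩⟩
  · intro u _ v _
    by_cases hu : u ∈ X <;> by_cases hv : v ∈ X <;> simp only [hu, hv, if_true, if_false]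
    · exact hB₁.ne (h₁.source_ne_target u (m₁ hu) v (m₁ hv))
    · exact hB _ _
    · exact (hB _ _).symm
    · exact hB₂.ne (h₂.source_ne_target u (m₂ hu) v (m₂ hv))
  · intro u _ v _ huv
    by_cases hu : u ∈ X <;> by_cases hv : v ∈ X <;> simp only [hu, hv, if_true, if_false]
    · exact hB₁.ne (h₁.source_ne u (m₁ hu) v (m₁ hv) huv)
    · exact hB _ _
    · exact (hB _ _).symm
    · exact hB₂.ne (h₂.source_ne u (m₂ hu) v (m₂ hv) huv)
  · intro u _ v _ huv
    by_cases hu : u ∈ X <;> by_cases hv : v ∈ X <;> simp only [hu, hv, if_true, if_false]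
    · exact hB₁.ne (h₁.target_ne u (m₁ hu) v (m₁ hv) huv)
    · exact hB _ _
    · exact (hB _ _).symm
    · exact hB₂.ne (h₂.target_ne u (m₂ hu) v (m₂ hv) huv)
  · intro u _ v _ huv
    by_cases hu : u ∈ X <;> by_cases hv : v ∈ X <;> simp only [hu, hv, if_true, if_false]
    · exact (chordCross_chordBlock _ _ (by norm_num) (by norm_num) _ _ _ _).trans
        (h₁.cross u (m₁ hu) v (m₁ hv) huv)
    · exact hmix u hu v hv
    · rw [chordCross_comm (hB _ _).symm (hB _ _).symm (hB _ _).symm (hB _ _).symm,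
        hmix v hv u hu, adjBit_comm]
    · exact (chordCross_chordBlock _ _ (by norm_num) (by norm_num) _ _ _ _).trans
        (h₂.cross u (m₂ hu) v (m₂ hv) huv)

end Gluing

section LocalComplementation

variable {V : Type*}

/-- The local complement of `G` at `u`: adjacency between neighbours of `u` is reversed. -/
def localComplement (G : SimpleGraph V) (u : V) : SimpleGraph V where
  Adj x y := x ≠ y ∧ ¬(G.Adj x y ↔ G.Adj u x ∧ G.Adj u y)
  symm := ⟨fun x y h => ⟨h.1.symm, by simpa [G.adj_comm, and_comm] using h.2⟩⟩
  loopless := ⟨fun x h => h.1 rfl⟩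

theorem localComplement_adj {G : SimpleGraph V} {u x y : V} :
    (localComplement G u).Adj x y ↔ x ≠ y ∧ ¬(G.Adj x y ↔ G.Adj u x ∧ G.Adj u y) := Iff.rfl

theorem localComplement_adj_self_left {G : SimpleGraph V} {u y : V} :
    (localComplement G u).Adj u y ↔ G.Adj u y := by
  have := G.ne_of_adj (a := u) (b := y)
  simp [localComplement_adj]
  tauto

theorem localComplement_localComplement (G : SimpleGraph V) (u : V) :
    localComplement (localComplement G u) u = G := by
  ext x y
  have := G.ne_of_adj (a := x) (b := y)
  rw [localComplement_adj, localComplement_adj_self_left, localComplement_adj_self_left,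
    localComplement_adj]
  tauto

theorem adjBit_localComplement (G : SimpleGraph V) (u : V) {x y : V} (hxy : x ≠ y) :
    adjBit (localComplement G u) x y = adjBit G x y + adjBit G u x * adjBit G u y := by
  classical
  unfold adjBit
  rw [localComplement_adj]
  grind

theorem cutRankLeOne_iff {G : SimpleGraph V} {X : Set V} :
    CutRankLeOne G X ↔ ∃ f g : V → Prop, ∀ x ∈ X, ∀ y ∉ X, (G.Adj x y ↔ f x ∧ g y) := by
  constructor
  · intro h
    refine ⟨fun x => ∃ y ∉ X, G.Adj x y, fun y => ∃ x ∈ X, G.Adj x y, fun x hx y hy =>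
      ⟨fun hxy => ⟨⟨y, hy, hxy⟩, ⟨x, hx, hxy⟩⟩, ?_⟩⟩
    rintro ⟨⟨y', hy', hxy'⟩, ⟨x', hx', hxy⟩⟩
    exact h x hx x' hx' y' hy' y hy hxy' hxy
  · rintro ⟨f, g, h⟩ x hx x' hx' y hy y' hy' hxy hxy'
    rw [h x hx y hy] at hxy
    rw [h x' hx' y' hy'] at hxy'
    exact (h x hx y' hy').2 ⟨hxy.1, hxy'.2⟩

theorem CutRankLeOne.localComplement {G : SimpleGraph V} {X : Set V} (h : CutRankLeOne G X)
    (u : V) : CutRankLeOne (localComplement G u) X := by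
  obtain ⟨f, g, h⟩ := cutRankLeOne_iff.1 h
  refine cutRankLeOne_iff.2 ?_
  by_cases hu : u ∈ X
  · refine ⟨fun x => ¬(f x ↔ G.Adj u x ∧ f u), g, fun x hx y hy => ?_⟩
    have hxy : x ≠ y := by rintro rfl; exact hy hx
    rw [localComplement_adj, h x hx y hy, h u hu y hy]
    tauto
  · refine ⟨f, fun y => ¬(g y ↔ g u ∧ G.Adj u y), fun x hx y hy => ?_⟩
    have hxy : x ≠ y := by rintro rfl; exact hy hx
    rw [localComplement_adj, h x hx y hy, G.adj_comm u x, h x hx u hu]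
    tauto

/-- A connected graph that is prime with respect to split decomposition. -/
structure IsPrimeGraph (G : SimpleGraph V) : Prop where
  exists_adj : ∀ X : Set V, X.Nonempty → Xᶜ.Nonempty → ∃ x ∈ X, ∃ y ∉ X, G.Adj x y
  not_split : ∀ X : Set V, CutRankLeOne G X → X.Nontrivial → ¬Xᶜ.Nontrivial

theorem IsPrimeGraph.localComplement {G : SimpleGraph V} (h : IsPrimeGraph G) (u : V) :
    IsPrimeGraph (localComplement G u) where
  exists_adj X hX hX' := by
    obtain ⟨x, hx, y, hy, hxy⟩ := h.exists_adj X hX hX'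
    by_cases hadj : (_root_.localComplement G u).Adj x y
    · exact ⟨x, hx, y, hy, hadj⟩
    · have hu : G.Adj u x ∧ G.Adj u y := by
        have := hxy.ne
        rw [localComplement_adj] at hadj
        tauto
      by_cases huX : u ∈ X
      · exact ⟨u, huX, y, hy, localComplement_adj_self_left.2 hu.2⟩
      · exact ⟨x, hx, u, huX, (localComplement_adj_self_left.2 hu.1).symm⟩
  not_split X hX := by
    have := hX.localComplement u
    rw [localComplement_localComplement] at this
    exact h.not_split X this

open Classical in
/-- The effect of a local complementation at `u` on solutions of the Naji system. The parameter
`m` plays the role of the entry of `β` at `(u, u)`. -/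
noncomputable def localComplementNaji (G : SimpleGraph V) (β : V → V → ZMod 2) (u : V) (m : ZMod 2)
    (x y : V) : ZMod 2 :=
  β x y + (1 + adjBit G u x) * (if x = u then m else β u x) +
    adjBit G u x * (if y = u then m else β u y)

theorem NajiSolution.localComplement {G : SimpleGraph V} {β : V → V → ZMod 2}
    (h : NajiSolution G β) (u : V) (m : ZMod 2) :
    NajiSolution (localComplement G u) (localComplementNaji G β u m) := by
  obtain ⟨h1, h2, h3⟩ := h
  refine ⟨fun v w => ?_, fun x v w => ?_, fun x v w => ?_⟩
  · have e1 := h1 v w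
    have := G.adj_comm u v
    unfold localComplementNaji adjBit
    rw [localComplement_adj]
    grind
  · intro hxv' hxw'
    have := G.adj_comm v w
    have := G.adj_comm u v
    have := G.adj_comm u w
    have := G.adj_comm u x
    have := G.adj_comm v x
    have := G.adj_comm w x
    unfold localComplementNaji adjBit
    simp only [localComplement_adj]
    grind
  · intro hvw'
    have := G.adj_comm v w
    have := G.adj_comm u v
    have := G.adj_comm u w
    have := G.adj_comm u x
    have := G.adj_comm v x
    have := G.adj_comm w x
    unfold localComplementNaji adjBit
    simp only [localComplement_adj]
    grind

end LocalComplementation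

section Betweenness

variable {V : Type*} {G : SimpleGraph V} {β : V → V → ZMod 2}

theorem zmod_two_eq_of_ne_of_ne {a b c : ZMod 2} (ha : a ≠ c) (hb : b ≠ c) : a = b := by
  revert a b c; decide

/-- If `u` separates `v` from `w` and `v` separates `u` from `w`, then the component of `w` in the
graph minus the closed neighbourhoods of `u` and `v` is the small side of a split. -/
theorem IsPrimeGraph.adj_of_separates (hG : IsPrimeGraph G) (h : NajiSolution G β) {u v w : V}
    (huv : u ≠ v) (huw : u ≠ w) (hvw : v ≠ w) (hauv : ¬G.Adj u v) (hauw : ¬G.Adj u w)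
    (havw : ¬G.Adj v w) (hu : β u v ≠ β u w) (hv : β v u ≠ β v w) :
    (∃ s, G.Adj w s) ∧ (∀ s, G.Adj w s → G.Adj u s ∧ G.Adj v s) ∧ β w u ≠ β w v := by
  obtain ⟨h1, h2, h3⟩ := h
  let C : Set V := {c | Relation.ReflTransGen
    (fun a b => G.Adj a b ∧ b ≠ u ∧ b ≠ v ∧ ¬G.Adj u b ∧ ¬G.Adj v b) w c}
  have hwC : w ∈ C := Relation.ReflTransGen.refl
  have hC : ∀ c ∈ C, c ≠ u ∧ c ≠ v ∧ ¬G.Adj u c ∧ ¬G.Adj v c ∧ β u c = β u w ∧ β v c = β v w := by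
    intro c hc
    induction hc with
    | refl => exact ⟨huw.symm, hvw.symm, hauw, havw, rfl, rfl⟩
    | tail _ hbc ih =>
      obtain ⟨hbu, hbv, hub, hvb, eu, ev⟩ := ih
      obtain ⟨hadj, hcu, hcv, huc, hvc⟩ := hbc
      refine ⟨hcu, hcv, huc, hvc, ?_, ?_⟩
      · rw [← eu]; have := h2 u _ _ hbu.symm hcu.symm hadj hub huc; grind
      · rw [← ev]; have := h2 v _ _ hbv.symm hcv.symm hadj hvb hvc; grind
  have hbd : ∀ c ∈ C, ∀ s ∉ C, G.Adj c s → G.Adj u s ∧ G.Adj v s ∧ β c u ≠ β c v := by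
    intro c hc s hs hcs
    obtain ⟨hcu, hcv, huc, hvc, eu, ev⟩ := hC c hc
    have hsu : s ≠ u := by rintro rfl; exact huc hcs.symm
    have hsv : s ≠ v := by rintro rfl; exact hvc hcs.symm
    have hor : G.Adj u s ∨ G.Adj v s := by
      by_contra! hcon
      exact hs (Relation.ReflTransGen.tail hc ⟨hcs, hsu, hsv, hcon.1, hcon.2⟩)
    have hus : G.Adj u s := by
      by_contra hus
      have e1 := h2 u c s hcu.symm hsu.symm hcs huc hus
      have e2 := h2 u v s huv hsu.symm (hor.resolve_left hus) hauv hus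
      grind
    have hvs : G.Adj v s := by
      by_contra hvs
      have e1 := h2 v c s hcv.symm hsv.symm hcs hvc hvs
      have e2 := h2 v u s huv.symm hsv.symm (hor.resolve_right hvs) (fun h => hauv h.symm) hvs
      grind
    refine ⟨hus, hvs, ?_⟩
    have e1 := h3 s u c hcu.symm hus.symm hcs.symm huc
    have e2 := h3 s v c hcv.symm hvs.symm hcs.symm hvc
    have e3 := h3 s u v huv hus.symm hvs.symm hauv
    have e4 := zmod_two_eq_zero_or_one (β u v)
    have e5 := zmod_two_eq_zero_or_one (β v u)
    have e6 := zmod_two_eq_zero_or_one (β u w)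
    have e7 := zmod_two_eq_zero_or_one (β v w)
    grind
  have huC : u ∉ C := fun h => (hC u h).1 rfl
  have hvC : v ∉ C := fun h => (hC v h).2.1 rfl
  have hcut : CutRankLeOne G C := by
    intro x hx x' hx' y hy y' hy' hxy hxy'
    by_contra hadj
    obtain ⟨hxu, hxv, hux, hvx, -, -⟩ := hC x hx
    have hne : x ≠ y' := by rintro rfl; exact hy' hx
    have e1 := h2 x u y' hxu hne (hbd x' hx' y' hy' hxy').1 (fun h => hux h.symm) hadj
    have e2 := h2 x v y' hxv hne (hbd x' hx' y' hy' hxy').2.1 (fun h => hvx h.symm) hadj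
    exact (hbd x hx y hy hxy).2.2 (by grind)
  have hsub : C.Subsingleton := by
    by_contra hnt
    exact hG.not_split C hcut (Set.not_subsingleton_iff.1 hnt) ⟨u, huC, v, hvC, huv⟩
  have hnb : ∀ s, G.Adj w s → s ∉ C := fun s hs hsC => hs.ne (hsub hwC hsC)
  obtain ⟨x, hx, s, hs, hxs⟩ := hG.exists_adj C ⟨w, hwC⟩ ⟨u, huC⟩
  obtain rfl : x = w := hsub hx hwC
  exact ⟨⟨s, hxs⟩, fun s hs => ⟨(hbd x hx s (hnb s hs) hs).1, (hbd x hx s (hnb s hs) hs).2.1⟩,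
    (hbd x hx s hs hxs).2.2⟩

/-- In a prime graph, out of three pairwise disjoint chords at most one separates the others. -/
theorem IsPrimeGraph.not_separates (hG : IsPrimeGraph G) (h : NajiSolution G β) {u v w : V}
    (huv : u ≠ v) (huw : u ≠ w) (hvw : v ≠ w) (hauv : ¬G.Adj u v) (hauw : ¬G.Adj u w)
    (havw : ¬G.Adj v w) (hu : β u v ≠ β u w) : β v u = β v w := by
  by_contra hv
  obtain ⟨⟨s, hs⟩, hw, hwuv⟩ := hG.adj_of_separates h huv huw hvw hauv hauw havw hu hv
  obtain ⟨-, hu', -⟩ := hG.adj_of_separates h hvw huv.symm huw.symm havw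
    (fun h => hauv h.symm) (fun h => hauw h.symm) (fun h => hv h.symm) hwuv.symm
  obtain ⟨-, hv', -⟩ := hG.adj_of_separates h huw huv hvw.symm hauw hauv
    (fun h => havw h.symm) (fun h => hu h.symm) hwuv
  have hcut : CutRankLeOne G {u, v} := by
    intro x hx x' hx' y hy y' hy' _ hxy'
    rcases hx with rfl | rfl <;> rcases hx' with rfl | rfl
    · exact hxy'
    · exact (hv' _ hxy').1
    · exact (hu' _ hxy').1
    · exact hxy'
  have hsu : s ≠ u := by rintro rfl; exact G.loopless.irrefl _ (hw s hs).1
  have hsv : s ≠ v := by rintro rfl; exact G.loopless.irrefl _ (hw s hs).2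
  exact hG.not_split {u, v} hcut (Set.nontrivial_pair huv)
    ⟨w, by simp [huw.symm, hvw.symm], s, by simp [hsu, hsv], hs.ne⟩

theorem IsPrimeGraph.eq_or_eq_of_not_adj (hG : IsPrimeGraph G) (h : NajiSolution G β)
    (e : ZMod 2) {u x v : V} (hux : u ≠ x) (huv : u ≠ v) (hxv : x ≠ v) (haux : ¬G.Adj u x) :
    β u x = β u v + e * adjBit G u v ∨ β x u = β x v + e * adjBit G x v := by
  have h1 := h.1
  have h2 := h.2.1
  have h3 := h.2.2
  by_cases hauv : G.Adj u v <;> by_cases haxv : G.Adj x v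
  · have e1 := h1 u v hauv
    have e2 := h1 x v haxv
    have e3 := h3 v u x hux hauv.symm haxv.symm haux
    rw [adjBit_eq_one.2 hauv, adjBit_eq_one.2 haxv]
    have e4 := zmod_two_eq_zero_or_one (β u x)
    have e5 := zmod_two_eq_zero_or_one (β x u)
    have e6 := zmod_two_eq_zero_or_one (β u v)
    have e7 := zmod_two_eq_zero_or_one (β x v)
    have e8 := zmod_two_eq_zero_or_one e
    grind
  · have := h2 x u v hux.symm hxv hauv (fun h => haux h.symm) haxv
    rw [adjBit_eq_zero.2 haxv]
    grind
  · have := h2 u x v hux huv haxv haux hauv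
    rw [adjBit_eq_zero.2 hauv]
    grind
  · rw [adjBit_eq_zero.2 hauv, adjBit_eq_zero.2 haxv, mul_zero, add_zero, add_zero]
    by_contra! hcon
    exact hcon.2 (hG.not_separates h hux huv hxv haux hauv haxv hcon.1)

end Betweenness

section Reflection

/-- Reverse one of the two arcs between `a` and `b`, viewed as points of a circle. -/
noncomputable def arcReflect (a b p : ℚ) : ℚ :=
  if a < b then if a < p ∧ p < b then a + b - p else p
  else -if b < p ∧ p < a then a + b - p else p

/-- Whether `p` lies strictly between `a` and `b` on the line. -/
noncomputable def betweenBit (a b p : ℚ) : ZMod 2 :=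
  if p = a ∨ p = b then 0 else ltBit a p + ltBit b p

theorem arcReflect_surjective (a b : ℚ) : Function.Surjective (arcReflect a b) := by
  intro q
  by_cases h : a < b
  · by_cases hq : a < q ∧ q < b
    · exact ⟨a + b - q, by unfold arcReflect; grind⟩
    · exact ⟨q, by unfold arcReflect; grind⟩
  · by_cases hq : b < -q ∧ -q < a
    · exact ⟨a + b + q, by unfold arcReflect; grind⟩
    · exact ⟨-q, by unfold arcReflect; grind⟩

theorem betweenBit_of_lt {a b : ℚ} (hab : a < b) (p : ℚ) :
    betweenBit a b p = if a < p ∧ p < b then 1 else 0 := by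
  unfold betweenBit ltBit
  grind

theorem betweenBit_comm (a b p : ℚ) : betweenBit a b p = betweenBit b a p := by
  unfold betweenBit
  simp only [or_comm, add_comm]

theorem ltBit_arcReflect {a b p q : ℚ} (hab : a ≠ b) (hpq : p ≠ q) :
    ltBit (arcReflect a b p) (arcReflect a b q) =
      ltBit p q + betweenBit a b p * betweenBit a b q + ltBit b a := by
  rcases lt_or_gt_of_ne hab with hab | hab
  · rw [betweenBit_of_lt hab, betweenBit_of_lt hab]
    simp only [ltBit, arcReflect, hab, hab.not_gt, if_true, if_false]
    by_cases hp : a < p ∧ p < b <;> by_cases hq : a < q ∧ q < b <;>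
      simp only [hp, hq, if_true, if_false, and_self] <;> grind
  · rw [betweenBit_comm, betweenBit_of_lt hab, betweenBit_comm, betweenBit_of_lt hab]
    simp only [ltBit, arcReflect, hab, hab.not_gt, if_true, if_false, neg_lt_neg_iff]
    by_cases hp : b < p ∧ p < a <;> by_cases hq : b < q ∧ q < a <;>
      simp only [hp, hq, if_true, if_false, and_self] <;> grind

theorem arcReflect_injective (a b : ℚ) : Function.Injective (arcReflect a b) := by
  intro p q h
  by_contra hpq
  by_cases hab : a = b
  · subst hab
    have h' : ∀ r, ¬(a < r ∧ r < a) := fun r hr => lt_asymm hr.1 hr.2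
    simp only [arcReflect, lt_irrefl, h', if_false, neg_inj] at h
    exact hpq h
  · have h1 := ltBit_arcReflect hab hpq
    have h2 := ltBit_arcReflect hab (Ne.symm hpq)
    rw [h] at h1 h2
    have h3 : ltBit p q + ltBit q p = 1 := by
      unfold ltBit
      grind
    grind

theorem chordCross_arcReflect {a b c d p q : ℚ} (hab : a ≠ b) (hcp : c ≠ p) (hcq : c ≠ q)
    (hdp : d ≠ p) (hdq : d ≠ q) :
    chordCross (arcReflect a b c) (arcReflect a b d) (arcReflect a b p) (arcReflect a b q) =
      chordCross c d p q + (betweenBit a b c + betweenBit a b d) *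
        (betweenBit a b p + betweenBit a b q) := by
  unfold chordCross
  rw [ltBit_arcReflect hab hcp, ltBit_arcReflect hab hcq, ltBit_arcReflect hab hdp,
    ltBit_arcReflect hab hdq]
  grind

theorem chordSide_arcReflect {a b c d p : ℚ} (hab : a ≠ b) (hcd : c ≠ d) (hcp : c ≠ p)
    (hdp : d ≠ p) :
    chordSide (arcReflect a b c) (arcReflect a b d) (arcReflect a b p) =
      chordSide c d p + (betweenBit a b c + betweenBit a b d) * betweenBit a b p +
        betweenBit a b c * betweenBit a b d + ltBit b a := by
  unfold chordSide
  rw [ltBit_arcReflect hab hcp, ltBit_arcReflect hab hdp, ltBit_arcReflect hab hcd.symm]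
  grind

theorem betweenBit_add_betweenBit {a b c d : ℚ} (hca : c ≠ a) (hcb : c ≠ b) (hda : d ≠ a)
    (hdb : d ≠ b) : betweenBit a b c + betweenBit a b d = chordCross a b c d := by
  unfold betweenBit chordCross
  grind

/-- Points arbitrarily close to `p` on a prescribed side. -/
theorem exists_ltBit_eq {F : Set ℚ} (hF : F.Finite) (p : ℚ) (e : ZMod 2) :
    ∃ q, q ∉ F ∧ ltBit p q = e ∧ ∀ r ∈ F, r ≠ p → ltBit r q = ltBit r p := by
  have hnear : ∀ᶠ q in nhds p, ∀ r ∈ F, (r < p → r < q) ∧ (p < r → q < r) := by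
    rw [Filter.eventually_all_finite hF]
    intro r _
    rcases lt_trichotomy r p with h | rfl | h
    · filter_upwards [eventually_gt_nhds h] with q hq
      exact ⟨fun _ => hq, fun h' => absurd h' h.not_gt⟩
    · exact .of_forall fun q => ⟨fun h => absurd h (lt_irrefl _), fun h => absurd h (lt_irrefl _)⟩
    · filter_upwards [eventually_lt_nhds h] with q hq
      exact ⟨fun h' => absurd h' h.not_gt, fun _ => hq⟩
  rcases zmod_two_eq_zero_or_one e with rfl | rfl
  · obtain ⟨q, hq, hlt⟩ := ((hnear.filter_mono nhdsWithin_le_nhds).and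
      (self_mem_nhdsWithin : Set.Iio p ∈ nhdsWithin p (Set.Iio p))).exists
    have hlt : q < p := hlt
    refine ⟨q, fun hqF => ?_, by simp [ltBit, hlt.le], fun r hr hrp => ?_⟩
    · exact lt_irrefl _ ((hq q hqF).1 hlt)
    · have := hq r hr
      unfold ltBit
      grind
  · obtain ⟨q, hq, hlt⟩ := ((hnear.filter_mono nhdsWithin_le_nhds).and
      (self_mem_nhdsWithin : Set.Ioi p ∈ nhdsWithin p (Set.Ioi p))).exists
    have hlt : p < q := hlt
    refine ⟨q, fun hqF => ?_, by simp [ltBit, hlt], fun r hr hrp => ?_⟩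
    · exact lt_irrefl _ ((hq q hqF).2 hlt)
    · have := hq r hr
      unfold ltBit
      grind

end Reflection

section Realization

variable {V : Type*} {G : SimpleGraph V} {β : V → V → ZMod 2} {W : Set V} {s t : V → ℚ}

/-- A chord model for the subgraph of `G` induced by `W` in which the directions of the chords
induce the solution `β` of the Naji system. -/
structure Realizes (G : SimpleGraph V) (β : V → V → ZMod 2) (W : Set V) (s t : V → ℚ) : Prop
    extends ChordModel G W s t where
  side : ∀ u ∈ W, ∀ v ∈ W, u ≠ v → chordSide (s u) (t u) (s v) = β u v

theorem zmod_two_mul_eq {a b c : ZMod 2} (h : b + c = a) : b * c = (1 + a) * b := by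
  revert a b c; decide

namespace Realizes

theorem betweenBit_source (h : Realizes G β W s t) {u x : V} (hu : u ∈ W) (hx : x ∈ W)
    (hxu : x ≠ u) : betweenBit (s u) (t u) (s x) = β u x + ltBit (t u) (s u) := by
  have h1 := h.side u hu x hx hxu.symm
  have h2 := h.source_ne x hx u hu hxu
  have h3 := h.source_ne_target x hx u hu
  unfold chordSide at h1
  unfold betweenBit
  grind

theorem betweenBit_source_add_betweenBit_target (h : Realizes G β W s t) {u x : V} (hu : u ∈ W)
    (hx : x ∈ W) :
    betweenBit (s u) (t u) (s x) + betweenBit (s u) (t u) (t x) = adjBit G u x := by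
  by_cases hxu : x = u
  · subst hxu
    rw [adjBit_eq_zero.2 (G.loopless.irrefl x)]
    simp [betweenBit]
  · rw [betweenBit_add_betweenBit (h.source_ne x hx u hu hxu) (h.source_ne_target x hx u hu)
      (h.target_ne_source hx hu) (h.target_ne x hx u hu hxu), h.cross u hu x hx (Ne.symm hxu)]

theorem localComplement (h : Realizes G β W s t) {u : V} (hu : u ∈ W) :
    Realizes (localComplement G u) (localComplementNaji G β u (ltBit (t u) (s u))) W
      (fun x => arcReflect (s u) (t u) (s x)) (fun x => arcReflect (s u) (t u) (t x)) where
  source_ne_target x hx y hy := (arcReflect_injective _ _).ne (h.source_ne_target x hx y hy)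
  source_ne x hx y hy hxy := (arcReflect_injective _ _).ne (h.source_ne x hx y hy hxy)
  target_ne x hx y hy hxy := (arcReflect_injective _ _).ne (h.target_ne x hx y hy hxy)
  cross x hx y hy hxy := by
    rw [chordCross_arcReflect (h.source_ne_target u hu u hu) (h.source_ne x hx y hy hxy)
      (h.source_ne_target x hx y hy) (h.target_ne_source hx hy) (h.target_ne x hx y hy hxy),
      h.cross x hx y hy hxy, h.betweenBit_source_add_betweenBit_target hu hx,
      h.betweenBit_source_add_betweenBit_target hu hy, adjBit_localComplement G u hxy]
  side x hx y hy hxy := by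
    have h1 := h.betweenBit_source_add_betweenBit_target hu hx
    have h2 := zmod_two_eq_zero_or_one (adjBit G u x)
    rw [chordSide_arcReflect (h.source_ne_target u hu u hu) (h.source_ne_target x hx x hx)
      (h.source_ne x hx y hy hxy) (h.target_ne_source hx hy), h.side x hx y hy hxy, h1]
    unfold localComplementNaji
    by_cases hxu : x = u
    · subst hxu
      rw [adjBit_eq_zero.2 (G.loopless.irrefl x)]
      simp [betweenBit]
    · rw [h.betweenBit_source hu hx hxu] at h1 ⊢
      rw [if_neg hxu]
      by_cases hyu : y = u
      · subst hyu
        have h3 : betweenBit (s y) (t y) (s y) = 0 := by simp [betweenBit]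
        rw [h3, if_pos rfl, zmod_two_mul_eq h1]
        grind
      · rw [h.betweenBit_source hu hy hyu, if_neg hyu, zmod_two_mul_eq h1]
        grind

theorem chordSide_arcReflect (h : Realizes G β W s t) {u x : V} (hu : u ∈ W) (hx : x ∈ W)
    (hxu : x ≠ u) {p : ℚ} (hp : ∀ x ∈ W, p ≠ s x ∧ p ≠ t x) :
    chordSide (arcReflect (s u) (t u) (s x)) (arcReflect (s u) (t u) (t x))
      (arcReflect (s u) (t u) p) = chordSide (s x) (t x) p + (1 + adjBit G u x) * β u x +
        adjBit G u x * chordSide (s u) (t u) p := by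
  have h1 := h.betweenBit_source_add_betweenBit_target hu hx
  have h2 := zmod_two_eq_zero_or_one (adjBit G u x)
  have h3 : betweenBit (s u) (t u) p = chordSide (s u) (t u) p + ltBit (t u) (s u) := by
    have := hp u hu
    unfold betweenBit chordSide
    grind
  rw [_root_.chordSide_arcReflect (h.source_ne_target u hu u hu) (h.source_ne_target x hx x hx)
    (hp x hx).1.symm (hp x hx).2.symm, h1, h3]
  rw [h.betweenBit_source hu hx hxu] at h1 ⊢
  rw [zmod_two_mul_eq h1]
  grind

end Realizes

end Realization

section Extension

variable {V : Type*} {G : SimpleGraph V} {β : V → V → ZMod 2} {W : Set V} {s t : V → ℚ} {v : V}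

namespace Realizes

/-- If every point that is not the end of a chord lies on the wrong side of some chord in `U`, then
each end of a chord `u` lies on the wrong side of some other chord in `U`. -/
theorem exists_chordSide_ne_of_endpoint (h : Realizes G β W s t) (hW : W.Finite) {U : Finset V}
    {τ : V → ZMod 2}
    (hbad : ∀ p, (∀ x ∈ W, p ≠ s x ∧ p ≠ t x) → ∃ x ∈ U, chordSide (s x) (t x) p ≠ τ x)
    (hU : ∀ x ∈ U, x ∈ W) {u : V} (hu : u ∈ W) {q : ℚ} (hq : q = s u ∨ q = t u) :
    ∃ x ∈ U, x ≠ u ∧ chordSide (s x) (t x) q ≠ τ x := by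
  have hF : (Set.image s W ∪ Set.image t W).Finite := (hW.image s).union (hW.image t)
  have hst := h.source_ne_target u hu u hu
  obtain ⟨c, hc⟩ : ∃ c : ZMod 2, ∀ p,
      (∀ r ∈ Set.image s W ∪ Set.image t W, r ≠ q → ltBit r p = ltBit r q) →
      chordSide (s u) (t u) p = ltBit q p + c := by
    rcases hq with rfl | rfl
    · refine ⟨0, fun p hp => ?_⟩
      have := hp (t u) (.inr ⟨u, hu, rfl⟩) hst.symm
      unfold chordSide
      grind
    · refine ⟨1, fun p hp => ?_⟩
      have := hp (s u) (.inl ⟨u, hu, rfl⟩) hst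
      have h1 : ltBit (s u) (t u) + ltBit (t u) (s u) = 1 := by
        unfold ltBit
        grind
      unfold chordSide
      grind
  obtain ⟨p, hpF, hqp, hp⟩ := exists_ltBit_eq hF q (τ u + c)
  have hpW : ∀ x ∈ W, p ≠ s x ∧ p ≠ t x := fun x hx =>
    ⟨fun h => hpF (.inl ⟨x, hx, h.symm⟩), fun h => hpF (.inr ⟨x, hx, h.symm⟩)⟩
  obtain ⟨x, hx, hxp⟩ := hbad p hpW
  have hxu : x ≠ u := by
    rintro rfl
    rw [hc p hp, hqp] at hxp
    grind
  have hxW := hU x hx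
  refine ⟨x, hx, hxu, ?_⟩
  have h1 : s x ≠ q := by
    rcases hq with rfl | rfl
    · exact h.source_ne x hxW u hu hxu
    · exact h.source_ne_target x hxW u hu
  have h2 : t x ≠ q := by
    rcases hq with rfl | rfl
    · exact h.target_ne_source hxW hu
    · exact h.target_ne x hxW u hu hxu
  unfold chordSide at hxp ⊢
  rwa [hp _ (.inl ⟨x, hxW, rfl⟩) h1, hp _ (.inr ⟨x, hxW, rfl⟩) h2] at hxp

/-- For a realization of part of a prime graph `G`, some point lies on the side of each chord that
a solution of the Naji system of `G` prescribes for an end of the chord of `v`. -/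
theorem exists_chordSide_eq (hG : IsPrimeGraph G) (hβ : NajiSolution G β)
    (h : Realizes G β W s t) (hW : W.Finite) (hv : v ∉ W) (e : ZMod 2) (U : Finset V)
    (hU : ∀ x ∈ U, x ∈ W) :
    ∃ p, (∀ x ∈ W, p ≠ s x ∧ p ≠ t x) ∧
      ∀ x ∈ U, chordSide (s x) (t x) p = β x v + e * adjBit G x v := by
  classical
  induction U using Finset.strongInduction generalizing G β s t with
  | H U ih =>
  by_contra hcon
  have hbad : ∀ p, (∀ x ∈ W, p ≠ s x ∧ p ≠ t x) →
      ∃ x ∈ U, chordSide (s x) (t x) p ≠ β x v + e * adjBit G x v := by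
    intro p hp
    by_contra! hcon'
    exact hcon ⟨p, hp, hcon'⟩
  have hF : (Set.image s W ∪ Set.image t W).Finite := (hW.image s).union (hW.image t)
  obtain ⟨p₀, hp₀, -⟩ := exists_ltBit_eq hF 0 0
  obtain ⟨u, hu, -⟩ := hbad p₀ fun x hx =>
    ⟨fun h => hp₀ (.inl ⟨x, hx, h.symm⟩), fun h => hp₀ (.inr ⟨x, hx, h.symm⟩)⟩
  have huW := hU u hu
  have hne : ∀ x ∈ W, x ≠ v := by rintro x hx rfl; exact hv hx
  have hpriv : ∀ y ∈ U, ∃ p, (∀ x ∈ W, p ≠ s x ∧ p ≠ t x) ∧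
      chordSide (s y) (t y) p ≠ β y v + e * adjBit G y v ∧
      ∀ x ∈ U, x ≠ y → chordSide (s x) (t x) p = β x v + e * adjBit G x v := by
    intro y hy
    obtain ⟨p, hp, hpU⟩ := ih (U.erase y) (Finset.erase_ssubset hy) hG hβ h
      fun x hx => hU x (Finset.mem_of_mem_erase hx)
    obtain ⟨x, hx, hxp⟩ := hbad p hp
    refine ⟨p, hp, ?_, fun x hx hxy => hpU x (Finset.mem_erase.2 ⟨hxy, hx⟩)⟩
    by_cases hxy : x = y
    · exact hxy ▸ hxp
    · exact absurd (hpU x (Finset.mem_erase.2 ⟨hxy, hx⟩)) hxp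
  obtain ⟨pu, -, hpu, hpu'⟩ := hpriv u hu
  have hadj : ∀ x ∈ U, x ≠ u → (chordSide (s x) (t x) (s u) ≠ β x v + e * adjBit G x v ∨
      chordSide (s x) (t x) (t u) ≠ β x v + e * adjBit G x v) → G.Adj u x := by
    intro x hx hxu hxe
    by_contra hnadj
    have hxW := hU x hx
    have h1 : chordCross (s u) (t u) (s x) (t x) = 0 :=
      (h.cross u huW x hxW hxu.symm).trans (adjBit_eq_zero.2 hnadj)
    have h2 : chordCross (s x) (t x) (s u) (t u) = 0 :=
      (h.cross x hxW u huW hxu).trans (adjBit_eq_zero.2 fun h => hnadj h.symm)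
    have h3 := chordSide_target (s x) (t x) (s u) (t u)
    have h4 := chordSide_eq_or_eq_of_not_cross (h.source_ne u huW x hxW hxu.symm)
      (h.source_ne_target u huW x hxW) h1 pu
    have h5 := hG.eq_or_eq_of_not_adj hβ e hxu.symm (hne u huW) (hne x hxW) hnadj
    have h6 := h.side u huW x hxW hxu.symm
    have h7 := h.side x hxW u huW hxu
    have h8 := hpu' x hx hxu
    grind
  obtain ⟨x, hx, hxu, hxs⟩ := h.exists_chordSide_ne_of_endpoint hW hbad hU huW (.inl rfl)
  obtain ⟨y, hy, hyu, hyt⟩ := h.exists_chordSide_ne_of_endpoint hW hbad hU huW (.inr rfl)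
  have hux := hadj x hx hxu (.inl hxs)
  have huy := hadj y hy hyu (.inr hyt)
  have hxy : x ≠ y := by
    rintro rfl
    have h1 := h.cross x (hU x hx) u huW hxu
    rw [adjBit_eq_one.2 hux.symm] at h1
    have h2 := chordSide_target (s x) (t x) (s u) (t u)
    have h3 := zmod_two_eq_of_ne_of_ne hxs hyt
    grind
  obtain ⟨px, -, hpx, hpx'⟩ := hpriv x hx
  obtain ⟨py, -, hpy, hpy'⟩ := hpriv y hy
  obtain ⟨p', hp', hpU'⟩ := ih (U.erase u) (Finset.erase_ssubset hu) (hG.localComplement u)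
    (hβ.localComplement u (ltBit (t u) (s u))) (h.localComplement huW)
    fun x hx => hU x (Finset.mem_of_mem_erase hx)
  obtain ⟨p, rfl⟩ := arcReflect_surjective (s u) (t u) p'
  have hp : ∀ x ∈ W, p ≠ s x ∧ p ≠ t x := fun x hx =>
    ⟨fun h => (hp' x hx).1 (congrArg _ h), fun h => (hp' x hx).2 (congrArg _ h)⟩
  have key : ∀ z ∈ U, z ≠ u → chordSide (s z) (t z) p = β z v + e * adjBit G z v +
      adjBit G u z * (chordSide (s u) (t u) p + (β u v + e * adjBit G u v)) := by
    intro z hz hzu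
    have h1 := hpU' z (Finset.mem_erase.2 ⟨hzu, hz⟩)
    rw [h.chordSide_arcReflect huW (hU z hz) hzu hp, adjBit_localComplement G u (hne z (hU z hz))]
      at h1
    unfold localComplementNaji at h1
    rw [if_neg hzu, if_neg (hne u huW).symm] at h1
    grind
  have hpu₀ : chordSide (s u) (t u) p ≠ β u v + e * adjBit G u v := by
    intro heq
    obtain ⟨z, hz, hzp⟩ := hbad p hp
    by_cases hzu : z = u
    · exact hzp (hzu ▸ heq)
    · have := key z hz hzu
      grind
  have hpx₀ : chordSide (s x) (t x) p ≠ β x v + e * adjBit G x v := by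
    have := key x hx hxu
    rw [adjBit_eq_one.2 hux] at this
    grind
  have hpy₀ : chordSide (s y) (t y) p ≠ β y v + e * adjBit G y v := by
    have := key y hy hyu
    rw [adjBit_eq_one.2 huy] at this
    grind
  refine not_three_pairings (a := s u) (a' := t u) (b := s x) (b' := t x) (c := s y) (c' := t y)
    (p := p) (q := pu) (r := px) (s := py) (zmod_two_eq_of_ne_of_ne hpu₀ hpu) ?_ ?_
    (zmod_two_eq_of_ne_of_ne hpx₀ hpx) ?_ ?_ (zmod_two_eq_of_ne_of_ne hpy₀ hpy) ?_ ?_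
  · rw [hpx' u hu hxu.symm, hpy' u hu hyu.symm]
  · rwa [hpx' u hu hxu.symm]
  · rw [hpu' x hx hxu, hpy' x hx hxy]
  · rwa [hpu' x hx hxu]
  · rw [hpu' y hy hyu, hpx' y hy hxy.symm]
  · rwa [hpu' y hy hyu]

end Realizes

/-- The subgraph of `G` induced by `W` is connected. -/
def IsConnectedOn (G : SimpleGraph V) (W : Set V) : Prop :=
  ∀ X ⊆ W, X.Nonempty → (W \ X).Nonempty → ∃ x ∈ X, ∃ y ∈ W \ X, G.Adj x y

theorem IsConnectedOn.insert (h : IsConnectedOn G W) {z : V} (hz : z ∈ W) (hzv : G.Adj z v) :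
    IsConnectedOn G (insert v W) := by
  intro X hX hne hne'
  by_cases h1 : (X ∩ W).Nonempty <;> by_cases h2 : (W \ X).Nonempty
  · obtain ⟨x, hx, y, hy, hxy⟩ := h (X ∩ W) Set.inter_subset_right h1
      (h2.mono fun y hy => ⟨hy.1, fun hy' => hy.2 hy'.1⟩)
    exact ⟨x, hx.1, y, ⟨.inr hy.1, fun hyX => hy.2 ⟨hyX, hy.1⟩⟩, hxy⟩
  · obtain ⟨y, hy, hyX⟩ := hne'
    have hWX : ∀ x ∈ W, x ∈ X := by
      intro x hx
      by_contra hxX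
      exact h2 ⟨x, hx, hxX⟩
    have : y = v := hy.resolve_right fun hyW => hyX (hWX y hyW)
    subst this
    exact ⟨z, hWX z hz, y, ⟨hy, hyX⟩, hzv⟩
  · obtain ⟨x, hx⟩ := hne
    have hXW : ∀ y ∈ W, y ∉ X := fun y hy hyX => h1 ⟨y, hyX, hy⟩
    have : x = v := (hX hx).resolve_right fun hxW => hXW x hxW hx
    subst this
    exact ⟨x, hx, z, ⟨.inr hz, hXW z hz⟩, hzv.symm⟩
  · by_cases hzX : z ∈ X
    · exact absurd ⟨z, hzX, hz⟩ h1
    · exact absurd ⟨z, hz, hzX⟩ h2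

/-- Adding a chord whose ends lie on the right sides of all other chords. -/
theorem Realizes.insert (h : Realizes G β W s t) (hβ : NajiSolution G β) (hW : IsConnectedOn G W)
    (hv : v ∉ W) {z : V} (hz : z ∈ W) (hzv : G.Adj z v) {p q : ℚ}
    (hp : ∀ x ∈ W, p ≠ s x ∧ p ≠ t x) (hq : ∀ x ∈ W, q ≠ s x ∧ q ≠ t x)
    (hps : ∀ x ∈ W, chordSide (s x) (t x) p = β x v)
    (hqs : ∀ x ∈ W, chordSide (s x) (t x) q = β x v + adjBit G x v) :
    ∃ s' t' : V → ℚ, Realizes G β (insert v W) s' t' := by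
  classical
  have hpq : p ≠ q := by
    rintro rfl
    have h1 := hqs z hz
    rw [hps z hz, adjBit_eq_one.2 hzv] at h1
    grind
  have hcross : ∀ x ∈ W, chordCross (s x) (t x) p q = adjBit G x v := by
    intro x hx
    have h1 := chordSide_target (s x) (t x) p q
    have h2 := hps x hx
    have h3 := hqs x hx
    grind
  have hne : ∀ x ∈ W, x ≠ v := by rintro x hx rfl; exact hv hx
  have hmodel : ChordModel G (Insert.insert v W) (Function.update s v p)
      (Function.update t v q) := by
    have hs : ∀ x ∈ W, Function.update s v p x = s x := fun x hx =>
      Function.update_of_ne (hne x hx) _ _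
    have ht : ∀ x ∈ W, Function.update t v q x = t x := fun x hx =>
      Function.update_of_ne (hne x hx) _ _
    refine ⟨?_, ?_, ?_, ?_⟩
    · rintro x (rfl | hx) y (rfl | hy)
      · simpa using hpq
      · rw [ht y hy]; simpa using (hp y hy).2
      · rw [hs x hx]; simpa using (hq x hx).1.symm
      · rw [hs x hx, ht y hy]; exact h.source_ne_target x hx y hy
    · rintro x (rfl | hx) y (rfl | hy) hxy
      · exact absurd rfl hxy
      · rw [hs y hy]; simpa using (hp y hy).1
      · rw [hs x hx]; simpa using (hp x hx).1.symm
      · rw [hs x hx, hs y hy]; exact h.source_ne x hx y hy hxy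
    · rintro x (rfl | hx) y (rfl | hy) hxy
      · exact absurd rfl hxy
      · rw [ht y hy]; simpa using (hq y hy).2
      · rw [ht x hx]; simpa using (hq x hx).2.symm
      · rw [ht x hx, ht y hy]; exact h.target_ne x hx y hy hxy
    · rintro x (rfl | hx) y (rfl | hy) hxy
      · exact absurd rfl hxy
      · rw [hs y hy, ht y hy, Function.update_self, Function.update_self, adjBit_comm,
          ← hcross y hy]
        exact chordCross_comm (hp y hy).1 (hp y hy).2 (hq y hy).1 (hq y hy).2
      · rw [hs x hx, ht x hx, Function.update_self, Function.update_self, hcross x hx]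
      · rw [hs x hx, hs y hy, ht x hx, ht y hy]; exact h.cross x hx y hy hxy
  have hold : ∀ x ∈ W, ∀ y, x ≠ y → y ∈ Insert.insert v W → chordSide (Function.update s v p x)
      (Function.update t v q x) (Function.update s v p y) = β x y := by
    rintro x hx y hxy (rfl | hy)
    · rw [Function.update_of_ne hxy, Function.update_of_ne hxy, Function.update_self, hps x hx]
    · rw [Function.update_of_ne (hne x hx), Function.update_of_ne (hne x hx),
        Function.update_of_ne (hne y hy), h.side x hx y hy hxy]
  generalize Function.update s v p = s' at hmodel hold
  generalize Function.update t v q = t' at hmodel hold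
  have hvW : v ∈ Insert.insert v W := .inl rfl
  have hnew : ∀ x ∈ W, chordSide (s' v) (t' v) (s' x) = β v x := by
    by_contra! hcon
    obtain ⟨y₀, hy₀, hne₀⟩ := hcon
    have hnbr : ∀ x ∈ W, G.Adj x v → chordSide (s' v) (t' v) (s' x) = β v x := by
      intro x hx hxv
      have h1 := hmodel.side_add_of_adj (.inr hx) hvW hxv
      have h2 := hold x hx v (hne x hx) hvW
      have h3 := hβ.1 x v hxv
      grind
    obtain ⟨x, ⟨hx, hxe⟩, y, ⟨hy, hye⟩, hxy⟩ := hW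
      {x | x ∈ W ∧ chordSide (s' v) (t' v) (s' x) = β v x} (fun x hx => hx.1)
      ⟨z, hz, hnbr z hz hzv⟩ ⟨y₀, hy₀, fun h => hne₀ h.2⟩
    refine hye ⟨hy, ?_⟩
    have hyv : ¬G.Adj v y := fun hvy => hye ⟨hy, hnbr y hy hvy.symm⟩
    by_cases hxv : G.Adj v x
    · have h1 := hmodel.side_add_of_adj_of_adj (.inr hx) hvW (.inr hy) (hne y hy).symm hxv.symm
        hxy hyv
      have h2 := hβ.2.2 x v y (hne y hy).symm hxv.symm hxy hyv
      have h3 := hold x hx v (hne x hx) hvW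
      have h4 := hold x hx y hxy.ne (.inr hy)
      have h5 := hold y hy v (hne y hy) hvW
      grind
    · have h1 := hmodel.side_eq_of_adj hvW (.inr hx) (.inr hy) (hne x hx).symm (hne y hy).symm hxy
        hxv hyv
      have h2 := hβ.2.1 v x y (hne x hx).symm (hne y hy).symm hxy hxv hyv
      grind
  refine ⟨s', t', { hmodel with side := ?_ }⟩
  rintro x (rfl | hx) y hy hxy
  · exact hnew y (hy.resolve_left hxy.symm)
  · exact hold x hx y hxy hy

theorem IsPrimeGraph.exists_realizes [Finite V] (hG : IsPrimeGraph G) (hβ : NajiSolution G β) :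
    ∃ s t : V → ℚ, Realizes G β Set.univ s t := by
  classical
  rcases isEmpty_or_nonempty V with hV | hV
  · exact ⟨fun _ => 0, fun _ => 0, ⟨⟨fun u => hV.elim u, fun u => hV.elim u, fun u => hV.elim u,
      fun u => hV.elim u⟩, fun u => hV.elim u⟩⟩
  obtain ⟨v₀⟩ := hV
  let Good : Set (Set V) := {W | W.Nonempty ∧ IsConnectedOn G W ∧
    ∃ s t : V → ℚ, Realizes G β W s t}
  have hgood : Good.Nonempty := by
    refine ⟨{v₀}, ⟨v₀, rfl⟩, ?_, fun _ => 0, fun _ => 1, ?_⟩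
    · rintro X hX ⟨x, hx⟩ ⟨y, hy, hyX⟩
      obtain rfl : x = v₀ := hX hx
      obtain rfl : y = x := hy
      exact absurd hx hyX
    · refine ⟨⟨?_, ?_, ?_, ?_⟩, ?_⟩
      · rintro u - v -; norm_num
      all_goals
        rintro u rfl v rfl huv
        exact absurd rfl huv
  obtain ⟨W, hW⟩ := (Set.toFinite Good).exists_maximal hgood
  obtain ⟨hne, hconn, s, t, h⟩ := hW.prop
  suffices W = Set.univ by
    subst this
    exact ⟨s, t, h⟩
  by_contra hWu
  obtain ⟨z, hz, v, hv, hzv⟩ := hG.exists_adj W hne (Set.nonempty_compl.2 hWu)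
  have hfin : W.Finite := Set.toFinite W
  obtain ⟨p, hp, hps⟩ := h.exists_chordSide_eq hG hβ hfin hv 0 hfin.toFinset
    fun x hx => hfin.mem_toFinset.1 hx
  obtain ⟨q, hq, hqs⟩ := h.exists_chordSide_eq hG hβ hfin hv 1 hfin.toFinset
    fun x hx => hfin.mem_toFinset.1 hx
  have hext := h.insert hβ hconn hv hz hzv hp hq
    (fun x hx => by simpa using hps x (hfin.mem_toFinset.2 hx))
    (fun x hx => by simpa using hqs x (hfin.mem_toFinset.2 hx))
  have hmem : Insert.insert v W ∈ Good := ⟨⟨v, .inl rfl⟩, hconn.insert hz hzv, hext⟩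
  exact hv (hW.2 hmem (Set.subset_insert v W) (.inl rfl))

end Extension

theorem NajiSolution.induce {V : Type*} {G : SimpleGraph V} {β : V → V → ZMod 2}
    (h : NajiSolution G β) (W : Set V) : NajiSolution (G.induce W) fun u v => β u v :=
  ⟨fun v w => h.1 v w, fun x v w hxv hxw => h.2.1 x v w (Subtype.coe_ne_coe.2 hxv)
    (Subtype.coe_ne_coe.2 hxw), fun x v w hvw => h.2.2 x v w (Subtype.coe_ne_coe.2 hvw)⟩

theorem NajiSolution.isCircleGraph {V : Type*} [Fintype V] [DecidableEq V] {G : SimpleGraph V}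
    {β : V → V → ZMod 2} (h : NajiSolution G β) : IsCircleGraph G := by
  classical
  induction hn : Fintype.card V using Nat.strong_induction_on generalizing V with
  | _ n ih =>
  subst hn
  have hind : ∀ W : Set V, Wᶜ.Nonempty → ∃ s t : V → ℚ, ChordModel G W s t := by
    rintro W ⟨x, hx⟩
    exact (ih _ (Fintype.card_subtype_lt hx) (h.induce W) rfl).exists_chordModel_of_induce
  by_cases hconn : ∀ X : Set V, X.Nonempty → Xᶜ.Nonempty → ∃ x ∈ X, ∃ y ∉ X, G.Adj x y
  · by_cases hsplit : ∀ X : Set V, CutRankLeOne G X → X.Nontrivial → ¬Xᶜ.Nontrivial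
    · obtain ⟨s, t, hst⟩ := IsPrimeGraph.exists_realizes ⟨hconn, hsplit⟩ h
      exact hst.toChordModel.isCircleGraph
    · push Not at hsplit
      obtain ⟨X, hX, hX₁, hX₂⟩ := hsplit
      obtain ⟨x, hx, y, hy, hxy⟩ := hconn X hX₁.nonempty hX₂.nonempty
      obtain ⟨x', hx', hne⟩ := hX₁.exists_ne x
      obtain ⟨y', hy', hne'⟩ := hX₂.exists_ne y
      obtain ⟨s₁, t₁, h₁⟩ := hind (insert y X) ⟨y', by simp_all⟩
      obtain ⟨s₂, t₂, h₂⟩ := hind (insert x Xᶜ) ⟨x', by simp_all⟩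
      obtain ⟨s, t, hst⟩ := ChordModel.exists_glue hx hy hxy hX h₁ h₂
      exact hst.isCircleGraph
  · push Not at hconn
    obtain ⟨X, hX₁, hX₂, hX⟩ := hconn
    obtain ⟨s₁, t₁, h₁⟩ := hind X hX₂
    obtain ⟨s₂, t₂, h₂⟩ := hind Xᶜ (by rwa [compl_compl])
    obtain ⟨s, t, hst⟩ := h₁.exists_union h₂ hX
    exact hst.isCircleGraph

/-- Naji's Theorem: a finite graph is a circle graph iff its Naji system has a
solution. -/
theorem naji_theorem {V : Type*} [Fintype V] [DecidableEq V]
    (G : SimpleGraph V) :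
    IsCircleGraph G ↔ ∃ β : V → V → ZMod 2, NajiSolution G β := by
  constructor
  · intro h
    obtain ⟨s, t, h⟩ := h.exists_chordModel
    exact ⟨_, h.najiSolution⟩
  · rintro ⟨β, h⟩
    exact h.isCircleGraph
end
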